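/- arXiv:1208.2633 — 2 statements merged into one kernel-verified Lean document; each statement's English description precedes it below -/
import Mathlib

section
/- With notation as in the paper, the double sum sum over D in H_{2g+1,q} of sum_{n=0}^{g} q^{-n} sum over monic non-square f of degree n of chi_D(f) is O((2q)^g). -/
open Polynomial UniqueFactorizationMonoid
open scoped Classical

/-- The set of monic polynomials of degree `n` over a finite field is finite. -/
theorem monicSet_finite (F : Type) [Field F] [Fintype F] (n : ℕ) :
    {f : Polynomial F | f.Monic ∧ f.natDegree = n}.Finite := by
  apply Set.Finite.subset (Set.finite_range
    (fun c : Fin n → F => X ^ n + ∑ i : Fin n, C (c i) * X ^ (i : ℕ)))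
  rintro f ⟨hm, rfl⟩
  refine ⟨fun i => f.coeff i, ?_⟩
  show X ^ f.natDegree + ∑ i : Fin f.natDegree, C (f.coeff ↑i) * X ^ (i : ℕ) = f
  rw [Fin.sum_univ_eq_sum_range (fun i => C (f.coeff i) * X ^ i) f.natDegree]
  exact (hm.as_sum).symm

/-- `Mn F n` is the (finite) set of monic polynomials of degree `n` in `F[T]`. -/
noncomputable def Mn (F : Type) [Field F] [Fintype F] (n : ℕ) : Finset (Polynomial F) :=
  (monicSet_finite F n).toFinset

/-- The quadratic residue symbol `(D/P)` for `P` irreducible in `𝔽_q[T]`: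
`0` if `P ∣ D`, `1` if `D` is a nonzero square mod `P`, and `-1` otherwise. -/
noncomputable def legP {F : Type} [Field F] [Fintype F] (D P : Polynomial F) : ℤ :=
  if P ∣ D then 0
  else if IsSquare (Ideal.Quotient.mk (Ideal.span {P}) D) then 1 else -1

/-- The Jacobi symbol `χ_D(f) = (D/f)` for `𝔽_q[T]`, extended multiplicatively over the monic
irreducible factors of `f`. -/
noncomputable def jacobiP {F : Type} [Field F] [Fintype F] (D f : Polynomial F) : ℤ :=
  ((normalizedFactors f).map (fun P => legP D P)).prod

section
variable {F : Type} [Field F]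

theorem exists_odd_count_normalizedFactors {f : F[X]} (hf : f.Monic) (hsq : ¬IsSquare f) :
    ∃ P ∈ normalizedFactors f, Odd ((normalizedFactors f).count P) := by
  by_contra! h
  refine hsq ?_
  rw [← hf.normalize_eq_self, ← prod_normalizedFactors_eq hf.ne_zero,
    Finset.prod_multiset_count]
  exact Finset.isSquare_prod _ fun P hP =>
    (Nat.not_odd_iff_even.1 (h P (Multiset.mem_toFinset.1 hP))).isSquare_pow _

theorem dvd_of_sq_mul_squarefree {A A' D D' : F[X]} (hD' : Squarefree D') (hA' : A' ≠ 0)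
    (h : A ^ 2 * D = A' ^ 2 * D') : A ∣ A' := by
  obtain ⟨x, hx⟩ := EuclideanDomain.gcd_dvd_left A A'
  obtain ⟨y, hy⟩ := EuclideanDomain.gcd_dvd_right A A'
  have hg : EuclideanDomain.gcd A A' ≠ 0 := fun h0 =>
    hA' (EuclideanDomain.gcd_eq_zero_iff.1 h0).2
  have hxy : IsCoprime x y := by
    obtain ⟨a, b, hab⟩ : ∃ a b, EuclideanDomain.gcd A A' = A * a + A' * b :=
      ⟨_, _, EuclideanDomain.gcd_eq_gcd_ab A A'⟩
    refine ⟨a, b, mul_left_cancel₀ hg ?_⟩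
    linear_combination -hab - a * hx - b * hy
  generalize EuclideanDomain.gcd A A' = d at *
  have h1 : x ^ 2 * D = y ^ 2 * D' := by
    refine mul_left_cancel₀ (pow_ne_zero 2 hg) ?_
    rw [hx, hy] at h
    linear_combination h
  have h2 : x ^ 2 ∣ D' := (hxy.pow (m := 2) (n := 2)).dvd_of_dvd_mul_left ⟨D, h1.symm⟩
  have h3 : IsUnit x := hD' x (by rwa [← sq])
  rw [hx, hy]
  exact mul_dvd_mul_left d h3.dvd

theorem exists_monic_sq_mul_squarefree {B : F[X]} (hB : B.Monic) :
    ∃ A D : F[X], A.Monic ∧ D.Monic ∧ Squarefree D ∧ A ^ 2 * D = B := by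
  induction hn : B.natDegree using Nat.strong_induction_on generalizing B with
  | _ n ih =>
    by_cases hsq : Squarefree B
    · exact ⟨1, B, monic_one, hB, hsq, by simp⟩
    · simp only [Squarefree, not_forall] at hsq
      obtain ⟨x, ⟨c, hc⟩, hx⟩ := hsq
      have hx0 : x ≠ 0 := by
        rintro rfl
        exact hB.ne_zero (by simpa using hc)
      have hy : (normalize x).Monic := monic_normalize hx0
      obtain ⟨c, hc⟩ : normalize x ^ 2 ∣ B :=
        (pow_dvd_pow_of_dvd (normalize_associated x).dvd 2).trans ⟨c, by rw [hc, sq]⟩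
      have hcm : c.Monic := (hy.pow 2).of_mul_monic_left (hc ▸ hB)
      have hdeg : 0 < (normalize x).natDegree := by
        rw [Nat.pos_iff_ne_zero]
        intro h0
        have := hy.natDegree_eq_zero.1 h0
        exact hx (normalize_eq_one.1 this)
      obtain ⟨A, D, hA, hD, hDs, hAD⟩ := ih c.natDegree (by
        rw [← hn, hc, (hy.pow 2).natDegree_mul hcm, hy.natDegree_pow]; omega) hcm rfl
      exact ⟨normalize x * A, D, hy.mul hA, hD, hDs, by rw [hc, ← hAD]; ring⟩

theorem exists_supported_mul_coprime {f : F[X]} (hf : f ≠ 0) {B : F[X]} (hB : B.Monic) :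
    ∃ h A : F[X], h.Monic ∧ A.Monic ∧ (∃ k : ℕ, h ∣ f ^ k) ∧ IsCoprime A f ∧ h * A = B := by
  induction hn : B.natDegree using Nat.strong_induction_on generalizing B with
  | _ n ih =>
    by_cases hc : IsCoprime B f
    · exact ⟨1, B, monic_one, hB, ⟨0, by simp⟩, hc, one_mul B⟩
    · obtain ⟨P, hP, hPB, hPf⟩ : ∃ P, Prime P ∧ P ∣ B ∧ P ∣ f := by
        by_contra! h
        exact hc (isCoprime_of_prime_dvd (fun h0 => hf h0.2) h)
      have hQ : (normalize P).Monic := monic_normalize hP.ne_zero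
      obtain ⟨C, hC⟩ := normalize_dvd_iff.2 hPB
      have hCm : C.Monic := hQ.of_mul_monic_left (hC ▸ hB)
      have hdeg : 0 < (normalize P).natDegree := by
        rw [Nat.pos_iff_ne_zero]
        intro h0
        exact hP.not_isUnit (normalize_eq_one.1 (hQ.natDegree_eq_zero.1 h0))
      obtain ⟨h, A, hh, hA, ⟨k, hk⟩, hcop, hhA⟩ := ih C.natDegree (by
        rw [← hn, hC, hQ.natDegree_mul hCm]; omega) hCm rfl
      refine ⟨normalize P * h, A, hQ.mul hh, hA, ⟨k + 1, ?_⟩, hcop, by rw [hC, ← hhA]; ring⟩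
      rw [pow_succ']
      exact mul_dvd_mul (normalize_dvd_iff.2 hPf) hk

theorem exists_prime_pow_mul_of_supported {h f : F[X]} (hh : h.Monic) (hf : f.Monic)
    (h1 : h ≠ 1) (hs : ∃ k : ℕ, h ∣ f ^ k) :
    ∃ (P h' f' : F[X]) (k : ℕ), P.Monic ∧ h'.Monic ∧ f'.Monic ∧ 0 < P.natDegree ∧ 0 < k ∧
      h = P ^ k * h' ∧ f = P * f' ∧ ∃ j : ℕ, h' ∣ f' ^ j := by
  obtain ⟨j, hj⟩ := hs
  have hu : ¬IsUnit h := fun hu => h1 (hh.eq_one_of_isUnit hu)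
  obtain ⟨P, hPm, hP, hPh⟩ := exists_monic_irreducible_factor h hu
  obtain ⟨k, h', hndvd, rfl⟩ := WfDvdMonoid.max_power_factor hh.ne_zero hP
  obtain ⟨f', rfl⟩ := hP.prime.dvd_of_dvd_pow (hPh.trans hj)
  refine ⟨P, h', f', k, hPm, (hPm.pow k).of_mul_monic_left hh, hPm.of_mul_monic_left hf,
    hP.natDegree_pos, ?_, rfl, rfl, j, ?_⟩
  · rw [Nat.pos_iff_ne_zero]
    rintro rfl
    exact hndvd (by simpa using hPh)
  · rw [mul_pow] at hj
    have hc : IsCoprime h' (P ^ j) := ((hP.coprime_iff_not_dvd).2 hndvd).symm.pow_right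
    exact hc.dvd_of_dvd_mul_left ((dvd_mul_left _ _).trans hj)

end

section
variable {F : Type} [Field F] [Fintype F]

theorem mem_Mn {n : ℕ} {f : F[X]} : f ∈ Mn F n ↔ f.Monic ∧ f.natDegree = n := by
  simp [Mn]

theorem card_Mn (n : ℕ) : (Mn F n).card = Fintype.card F ^ n := by
  have hcard : Fintype.card F ^ n = (Finset.univ : Finset (Fin n → F)).card := by simp
  rw [hcard]
  symm
  refine Finset.card_bij
    (fun (c : Fin n → F) _ => X ^ n + ∑ i : Fin n, C (c i) * X ^ (i : ℕ)) ?_ ?_ ?_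
  · intro c _
    have hlt := degree_sum_fin_lt c
    exact mem_Mn.2 ⟨monic_X_pow_add hlt, by
      rw [natDegree_eq_of_degree_eq (degree_add_eq_left_of_degree_lt (by simpa using hlt))]
      simp⟩
  · intro c _ d _ h
    have h' := add_left_cancel h
    funext i
    have := congrArg (fun p : F[X] => p.coeff i) h'
    simpa [finsetSum_coeff, coeff_C_mul, coeff_X_pow, Fin.val_inj] using this
  · intro f hf
    obtain ⟨hm, rfl⟩ := mem_Mn.1 hf
    refine ⟨fun i => f.coeff i, Finset.mem_univ _, ?_⟩
    rw [Fin.sum_univ_eq_sum_range (fun i => C (f.coeff i) * X ^ i) f.natDegree]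
    exact hm.as_sum.symm

theorem legP_eq_quadraticChar {P : F[X]} (hP : Irreducible P) :
    ∃ (K : Type) (_ : Field K) (_ : Fintype K) (φ : F[X] →+* K),
      Function.Surjective φ ∧ (∀ D, φ D = 0 ↔ P ∣ D) ∧ ringChar K = ringChar F ∧
      ∀ D, legP D P = quadraticChar K (φ D) := by
  have : Fact (Irreducible P) := ⟨hP⟩
  have : Module.Finite F (AdjoinRoot P) := (AdjoinRoot.powerBasis hP.ne_zero).finite
  have : Finite (AdjoinRoot P) := Module.finite_of_finite F
  refine ⟨AdjoinRoot P, inferInstance, Fintype.ofFinite _, AdjoinRoot.mk P,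
    AdjoinRoot.mk_surjective, fun D => AdjoinRoot.mk_eq_zero, ?_, fun D => ?_⟩
  · exact (Algebra.ringChar_eq F (AdjoinRoot P)).symm
  · simp only [legP, quadraticChar_apply, quadraticCharFun, ← AdjoinRoot.mk_eq_zero]
    congr

theorem legP_mul {P : F[X]} (hP : Irreducible P) (A B : F[X]) :
    legP (A * B) P = legP A P * legP B P := by
  obtain ⟨K, _, _, φ, -, -, -, h⟩ := legP_eq_quadraticChar hP
  rw [h, h, h, map_mul, map_mul]

theorem legP_congr {P A B : F[X]} (hP : Irreducible P) (hAB : P ∣ A - B) :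
    legP A P = legP B P := by
  obtain ⟨K, _, _, φ, -, h0, -, h⟩ := legP_eq_quadraticChar hP
  have := (h0 _).2 hAB
  rw [map_sub, sub_eq_zero] at this
  simp [h, this]

theorem legP_sq {P A : F[X]} (hP : Irreducible P) (hA : ¬P ∣ A) : legP (A ^ 2) P = 1 := by
  obtain ⟨K, _, _, φ, -, h0, -, h⟩ := legP_eq_quadraticChar hP
  rw [h, map_pow]
  exact quadraticChar_sq_one' (mt (h0 A).1 hA)

theorem legP_one {P : F[X]} (hP : Irreducible P) : legP 1 P = 1 := by
  simpa using legP_sq hP (A := 1) (fun h => hP.not_isUnit (isUnit_of_dvd_one h))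

theorem exists_legP_eq_neg_one {P : F[X]} (hP : Irreducible P) (h2 : ringChar F ≠ 2) :
    ∃ A, legP A P = -1 := by
  obtain ⟨K, _, _, φ, hs, -, hc, h⟩ := legP_eq_quadraticChar hP
  obtain ⟨a, ha⟩ := quadraticChar_exists_neg_one (F := K) (by rwa [hc])
  obtain ⟨A, rfl⟩ := hs a
  exact ⟨A, by rw [h, ha]⟩

theorem jacobiP_mul (A B f : F[X]) : jacobiP (A * B) f = jacobiP A f * jacobiP B f := by
  rw [jacobiP, jacobiP, jacobiP, ← Multiset.prod_map_mul]
  exact congrArg _ (Multiset.map_congr rfl fun P hP =>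
    legP_mul (irreducible_of_normalized_factor P hP) A B)

theorem jacobiP_congr {A B f : F[X]} (h : f ∣ A - B) : jacobiP A f = jacobiP B f :=
  congrArg _ (Multiset.map_congr rfl fun P hP =>
    legP_congr (irreducible_of_normalized_factor P hP)
      ((dvd_of_mem_normalizedFactors hP).trans h))

theorem jacobiP_eq_zero {A f : F[X]} (hf : f ≠ 0) (h : ¬IsCoprime A f) : jacobiP A f = 0 := by
  obtain ⟨P, hP, hA, hPf⟩ : ∃ P, Prime P ∧ P ∣ A ∧ P ∣ f := by
    by_contra! hc
    exact h (isCoprime_of_prime_dvd (fun h0 => hf h0.2) hc)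
  obtain ⟨Q, hQ, hPQ⟩ := exists_mem_normalizedFactors_of_dvd hf hP.irreducible hPf
  exact Multiset.prod_eq_zero (Multiset.mem_map.2 ⟨Q, hQ, if_pos (hPQ.dvd_iff_dvd_left.1 hA)⟩)

theorem jacobiP_sq {A f : F[X]} (hf : f ≠ 0) :
    jacobiP (A ^ 2) f = if IsCoprime A f then 1 else 0 := by
  split_ifs with h
  · refine Multiset.prod_eq_one fun x hx => ?_
    obtain ⟨P, hP, rfl⟩ := Multiset.mem_map.1 hx
    have hirr := irreducible_of_normalized_factor P hP
    exact legP_sq hirr fun hA =>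
      hirr.not_isUnit (h.isUnit_of_dvd' hA (dvd_of_mem_normalizedFactors hP))
  · rw [sq, jacobiP_mul, jacobiP_eq_zero hf h, zero_mul]

theorem abs_jacobiP_le_one {f : F[X]} (hf : f ≠ 0) (A : F[X]) : |jacobiP A f| ≤ 1 := by
  have h := jacobiP_sq hf (A := A)
  rw [sq, jacobiP_mul, ← sq] at h
  rw [← sq_le_one_iff_abs_le_one, h]
  split_ifs <;> norm_num

theorem exists_jacobiP_eq_neg_one {f : F[X]} (h2 : ringChar F ≠ 2) (hf : f.Monic)
    (hsq : ¬IsSquare f) : ∃ B, jacobiP B f = -1 := by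
  obtain ⟨P, hP, hodd⟩ := exists_odd_count_normalizedFactors hf hsq
  have hirr := irreducible_of_normalized_factor P hP
  obtain ⟨u, hu⟩ := exists_legP_eq_neg_one hirr h2
  set m := normalizedFactors f with hm
  set r := m.filter (fun Q => ¬Q = P) with hr
  have hcop : IsCoprime P r.prod := by
    rw [hirr.coprime_iff_not_dvd]
    intro hd
    obtain ⟨Q, hQ, hPQ⟩ := hirr.prime.exists_mem_multiset_dvd hd
    obtain ⟨hQm, hne⟩ := Multiset.mem_filter.1 hQ
    have hQirr := irreducible_of_normalized_factor Q hQm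
    refine hne ?_
    rw [← normalize_normalized_factor P hP, ← normalize_normalized_factor Q hQm]
    exact normalize_eq_normalize_iff_associated.2 (hirr.associated_of_dvd hQirr hPQ).symm
  obtain ⟨a, b, hab⟩ := hcop
  have hBP : legP (u * (b * r.prod) + a * P) P = -1 := by
    rw [← hu]
    refine legP_congr hirr ⟨a * (1 - u), ?_⟩
    linear_combination u * hab
  have hBQ : ∀ Q ∈ r, legP (u * (b * r.prod) + a * P) Q = 1 := by
    intro Q hQ
    have hQirr := irreducible_of_normalized_factor Q (Multiset.mem_filter.1 hQ).1
    rw [← legP_one hQirr]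
    refine legP_congr hQirr ((Multiset.dvd_prod hQ).trans ⟨b * (u - 1), ?_⟩)
    linear_combination hab
  refine ⟨u * (b * r.prod) + a * P, ?_⟩
  rw [jacobiP, ← hm, ← Multiset.filter_add_not (fun Q => Q = P) m, Multiset.map_add,
    Multiset.prod_add, Multiset.filter_eq', Multiset.map_replicate, Multiset.prod_replicate,
    hBP, hodd.neg_one_pow, ← hr, Multiset.map_congr rfl hBQ]
  simp

theorem sum_jacobiP_eq_zero {f : F[X]} (h2 : ringChar F ≠ 2) (hf : f.Monic)
    (hsq : ¬IsSquare f) {m : ℕ} (hm : f.natDegree ≤ m) :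
    ∑ B ∈ Mn F m, jacobiP B f = 0 := by
  obtain ⟨u, hu⟩ := exists_jacobiP_eq_neg_one h2 hf hsq
  have hcop : IsCoprime f u := by
    by_contra h
    rw [jacobiP_eq_zero hf.ne_zero (fun h' => h h'.symm)] at hu
    norm_num at hu
  let φ : F[X] → F[X] := fun B => B - B %ₘ f + (u * B) %ₘ f
  have hmod : ∀ B : F[X], f ∣ B - B %ₘ f := fun B => ⟨B /ₘ f, by
    linear_combination -modByMonic_add_div B f⟩
  have hdeg : ∀ B : F[X], (B %ₘ f).degree < m := fun B =>
    (degree_modByMonic_lt B hf).trans_le (degree_le_natDegree.trans (by exact_mod_cast hm))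
  have hmaps : ∀ B ∈ Mn F m, φ B ∈ Mn F m := by
    intro B hB
    obtain ⟨hBm, hBd⟩ := mem_Mn.1 hB
    have hBdeg : B.degree = m := by rw [degree_eq_natDegree hBm.ne_zero, hBd]
    have hlt : ((u * B) %ₘ f - B %ₘ f).degree < B.degree := by
      rw [hBdeg]
      exact (degree_sub_le _ _).trans_lt (max_lt (hdeg _) (hdeg _))
    have he : φ B = B + ((u * B) %ₘ f - B %ₘ f) := by simp only [φ]; ring
    rw [he]
    exact mem_Mn.2 ⟨hBm.add_of_left hlt, by
      rw [natDegree_eq_of_degree_eq (degree_add_eq_left_of_degree_lt hlt), hBd]⟩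
  have hcongr : ∀ B, f ∣ φ B - u * B := fun B => by
    have := (hmod B).sub (hmod (u * B))
    convert this using 1
    simp only [φ]; ring
  have hinj : Set.InjOn φ (Mn F m) := by
    intro A _ B _ hAB
    have h1 : f ∣ A - B := by
      refine hcop.dvd_of_dvd_mul_left ?_
      have := (hcongr B).sub (hcongr A)
      rw [hAB] at this
      convert this using 1
      ring
    have h3 : ∀ C D : F[X], f ∣ C - D → C %ₘ f = D %ₘ f := fun C D h => by
      rw [← sub_eq_zero, ← sub_modByMonic, (modByMonic_eq_zero_iff_dvd hf).2 h]
    have h4 := h3 A B h1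
    have h5 := h3 (u * A) (u * B) (by rw [← mul_sub]; exact h1.mul_left u)
    simp only [φ, h4, h5] at hAB
    linear_combination hAB
  have hsurj := Finset.surjOn_of_injOn_of_card_le φ (s := Mn F m) (t := Mn F m) hmaps hinj le_rfl
  have hsum : ∑ B ∈ Mn F m, jacobiP (φ B) f = ∑ B ∈ Mn F m, jacobiP B f :=
    Finset.sum_nbij φ hmaps hinj hsurj fun _ _ => rfl
  have : ∑ B ∈ Mn F m, jacobiP (φ B) f = -∑ B ∈ Mn F m, jacobiP B f := by
    rw [← Finset.sum_neg_distrib]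
    refine Finset.sum_congr rfl fun B _ => ?_
    rw [jacobiP_congr (hcongr B), jacobiP_mul, hu, neg_one_mul]
  omega

/-- The monic square-free polynomials of degree `n`. -/
noncomputable def squarefreeMn (F : Type) [Field F] [Fintype F] (n : ℕ) : Finset F[X] :=
  (Mn F n).filter (fun D => Squarefree D)

theorem mem_squarefreeMn {n : ℕ} {D : F[X]} :
    D ∈ squarefreeMn F n ↔ (D.Monic ∧ D.natDegree = n) ∧ Squarefree D := by
  simp [squarefreeMn, mem_Mn]

theorem sum_Mn_eq_sum_sq_mul_squarefree (φ : F[X] → ℤ) (j : ℕ) :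
    ∑ B ∈ Mn F (2 * j + 1), φ B = ∑ p ∈ Finset.HasAntidiagonal.antidiagonal j,
      ∑ x ∈ Mn F p.1 ×ˢ squarefreeMn F (2 * p.2 + 1), φ (x.1 ^ 2 * x.2) := by
  rw [Finset.sum_sigma']
  symm
  refine Finset.sum_bij (fun x _ => x.2.1 ^ 2 * x.2.2) ?_ ?_ ?_ fun _ _ => rfl
  · rintro ⟨⟨a, i⟩, A, D⟩ h
    simp only [Finset.mem_sigma, Finset.HasAntidiagonal.mem_antidiagonal, Finset.mem_product, mem_Mn,
      mem_squarefreeMn] at h ⊢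
    obtain ⟨rfl, ⟨hA, rfl⟩, ⟨hD, hd⟩, -⟩ := h
    exact ⟨(hA.pow 2).mul hD, by
      rw [(hA.pow 2).natDegree_mul hD, hA.natDegree_pow, hd]; ring⟩
  · rintro ⟨⟨a, i⟩, A, D⟩ h ⟨⟨a', i'⟩, A', D'⟩ h' heq
    simp only [Finset.mem_sigma, Finset.HasAntidiagonal.mem_antidiagonal, Finset.mem_product, mem_Mn,
      mem_squarefreeMn] at h h' heq
    obtain ⟨hai, ⟨hA, rfl⟩, ⟨hD, hd⟩, hs⟩ := h
    obtain ⟨hai', ⟨hA', rfl⟩, ⟨hD', hd'⟩, hs'⟩ := h'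
    obtain rfl : A = A' := eq_of_monic_of_associated hA hA'
      (associated_of_dvd_dvd (dvd_of_sq_mul_squarefree hs' hA'.ne_zero heq)
        (dvd_of_sq_mul_squarefree hs hA.ne_zero heq.symm))
    obtain rfl : D = D' := mul_left_cancel₀ (pow_ne_zero 2 hA.ne_zero) heq
    obtain rfl : i = i' := by omega
    rfl
  · intro B hB
    obtain ⟨hBm, hBd⟩ := mem_Mn.1 hB
    obtain ⟨A, D, hA, hD, hDs, rfl⟩ := exists_monic_sq_mul_squarefree hBm
    rw [(hA.pow 2).natDegree_mul hD, hA.natDegree_pow] at hBd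
    refine ⟨⟨(A.natDegree, j - A.natDegree), A, D⟩, ?_, rfl⟩
    simp only [Finset.mem_sigma, Finset.HasAntidiagonal.mem_antidiagonal, Finset.mem_product, mem_Mn,
      mem_squarefreeMn]
    exact ⟨by omega, ⟨hA, trivial⟩, ⟨hD, by omega⟩, hDs⟩

/-- The monic polynomials of degree `n` all of whose prime factors divide `f`. -/
noncomputable def supportedMn (f : F[X]) (n : ℕ) : Finset F[X] :=
  (Mn F n).filter (fun h => ∃ k : ℕ, h ∣ f ^ k)

/-- The monic polynomials of degree `n` coprime to `f`. -/
noncomputable def coprimeMn (f : F[X]) (n : ℕ) : Finset F[X] :=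
  (Mn F n).filter (fun A => IsCoprime A f)

theorem mem_supportedMn {f h : F[X]} {n : ℕ} :
    h ∈ supportedMn f n ↔ (h.Monic ∧ h.natDegree = n) ∧ ∃ k : ℕ, h ∣ f ^ k := by
  simp [supportedMn, mem_Mn]

theorem mem_coprimeMn {f h : F[X]} {n : ℕ} :
    h ∈ coprimeMn f n ↔ (h.Monic ∧ h.natDegree = n) ∧ IsCoprime h f := by
  simp [coprimeMn, mem_Mn]

theorem card_Mn_eq_sum_supported_coprime {f : F[X]} (hf : f ≠ 0) (a : ℕ) :
    Fintype.card F ^ a = ∑ p ∈ Finset.HasAntidiagonal.antidiagonal a,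
      (supportedMn f p.1).card * (coprimeMn f p.2).card := by
  simp_rw [← card_Mn, ← Finset.card_product]
  rw [← Finset.card_sigma]
  symm
  refine Finset.card_bij (fun x _ => x.2.1 * x.2.2) ?_ ?_ ?_
  · rintro ⟨⟨b, c⟩, h, A⟩ hx
    simp only [Finset.mem_sigma, Finset.HasAntidiagonal.mem_antidiagonal, Finset.mem_product, mem_Mn,
      mem_supportedMn, mem_coprimeMn] at hx ⊢
    obtain ⟨rfl, ⟨⟨hh, rfl⟩, -⟩, ⟨hA, rfl⟩, -⟩ := hx
    exact ⟨hh.mul hA, hh.natDegree_mul hA⟩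
  · rintro ⟨⟨b, c⟩, h, A⟩ hx ⟨⟨b', c'⟩, h', A'⟩ hx' heq
    simp only [Finset.mem_sigma, Finset.HasAntidiagonal.mem_antidiagonal, Finset.mem_product,
      mem_supportedMn, mem_coprimeMn] at hx hx' heq
    obtain ⟨-, ⟨⟨hh, rfl⟩, k, hk⟩, ⟨hA, rfl⟩, hc⟩ := hx
    obtain ⟨-, ⟨⟨hh', rfl⟩, k', hk'⟩, ⟨hA', rfl⟩, hc'⟩ := hx'
    obtain rfl : h = h' := by
      refine eq_of_monic_of_associated hh hh' (associated_of_dvd_dvd ?_ ?_)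
      · exact ((hc'.pow_right (n := k)).symm.of_isCoprime_of_dvd_left hk).dvd_of_dvd_mul_right
          ⟨A, heq.symm⟩
      · exact ((hc.pow_right (n := k')).symm.of_isCoprime_of_dvd_left hk').dvd_of_dvd_mul_right
          ⟨A', heq⟩
    obtain rfl : A = A' := mul_left_cancel₀ hh.ne_zero heq
    rfl
  · intro B hB
    obtain ⟨hBm, hBd⟩ := mem_Mn.1 hB
    obtain ⟨h, A, hh, hA, hk, hc, rfl⟩ := exists_supported_mul_coprime hf hBm
    rw [hh.natDegree_mul hA] at hBd
    refine ⟨⟨(h.natDegree, A.natDegree), h, A⟩, ?_, rfl⟩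
    simp only [Finset.mem_sigma, Finset.HasAntidiagonal.mem_antidiagonal, Finset.mem_product,
      mem_supportedMn, mem_coprimeMn]
    exact ⟨hBd, ⟨⟨hh, trivial⟩, hk⟩, ⟨hA, trivial⟩, hc⟩

theorem sum_jacobiP_eq_sum_coprime_squarefree {f : F[X]} (hf : f ≠ 0) (j : ℕ) :
    ∑ B ∈ Mn F (2 * j + 1), jacobiP B f = ∑ p ∈ Finset.HasAntidiagonal.antidiagonal j,
      ((coprimeMn f p.1).card : ℤ) * ∑ D ∈ squarefreeMn F (2 * p.2 + 1), jacobiP D f := by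
  rw [sum_Mn_eq_sum_sq_mul_squarefree]
  refine Finset.sum_congr rfl fun p _ => ?_
  simp_rw [jacobiP_mul, jacobiP_sq hf]
  rw [coprimeMn, Finset.card_filter]
  push_cast
  rw [Finset.sum_mul_sum, Finset.sum_product]

theorem mk_sum_squarefree_jacobiP {f : F[X]} (hf : f ≠ 0) :
    PowerSeries.mk (fun j => ∑ D ∈ squarefreeMn F (2 * j + 1), jacobiP D f) =
      (1 - (Fintype.card F : PowerSeries ℤ) * PowerSeries.X) *
        (PowerSeries.mk (fun a => ((supportedMn f a).card : ℤ)) *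
          PowerSeries.mk (fun j => ∑ B ∈ Mn F (2 * j + 1), jacobiP B f)) := by
  have hT : PowerSeries.mk (fun j => ∑ B ∈ Mn F (2 * j + 1), jacobiP B f) =
      PowerSeries.mk (fun a => ((coprimeMn f a).card : ℤ)) *
        PowerSeries.mk (fun j => ∑ D ∈ squarefreeMn F (2 * j + 1), jacobiP D f) := by
    ext j
    simp [PowerSeries.coeff_mul, sum_jacobiP_eq_sum_coprime_squarefree hf]
  have hq : PowerSeries.mk (fun a => (Fintype.card F : ℤ) ^ a) =
      PowerSeries.mk (fun a => ((supportedMn f a).card : ℤ)) *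
        PowerSeries.mk (fun a => ((coprimeMn f a).card : ℤ)) := by
    ext a
    simp only [PowerSeries.coeff_mul, PowerSeries.coeff_mk]
    exact_mod_cast card_Mn_eq_sum_supported_coprime hf a
  have hgeom : (1 - (Fintype.card F : PowerSeries ℤ) * PowerSeries.X) *
      PowerSeries.mk (fun a => (Fintype.card F : ℤ) ^ a) = 1 := by
    have hC : (Fintype.card F : PowerSeries ℤ) = PowerSeries.C (Fintype.card F : ℤ) := by simp
    ext (_ | n)
    · simp
    · rw [hC, sub_mul, one_mul, mul_assoc, map_sub, PowerSeries.coeff_C_mul,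
        PowerSeries.coeff_succ_X_mul]
      simp [PowerSeries.coeff_one, pow_succ']
  rw [hT, ← mul_assoc (PowerSeries.mk _) (PowerSeries.mk _), ← hq, ← mul_assoc, hgeom, one_mul]

/-- The convolution of the number of `h` supported on `f` with the complete character sums. -/
noncomputable def supportedConv (f : F[X]) (j : ℕ) : ℤ :=
  ∑ p ∈ Finset.HasAntidiagonal.antidiagonal j,
    ((supportedMn f p.1).card : ℤ) * ∑ B ∈ Mn F (2 * p.2 + 1), jacobiP B f

theorem abs_sum_squarefree_jacobiP_le {f : F[X]} (hf : f ≠ 0) (j : ℕ) :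
    |∑ D ∈ squarefreeMn F (2 * j + 1), jacobiP D f| ≤
      |supportedConv f j| + Fintype.card F * |supportedConv f (j - 1)| := by
  have h := congrArg (PowerSeries.coeff j) (mk_sum_squarefree_jacobiP hf)
  have hC : (Fintype.card F : PowerSeries ℤ) = PowerSeries.C (Fintype.card F : ℤ) := by simp
  rw [hC, sub_mul, one_mul, mul_assoc, map_sub, PowerSeries.coeff_C_mul,
    PowerSeries.coeff_mul, PowerSeries.coeff_mk] at h
  simp only [PowerSeries.coeff_mk] at h
  rw [h]
  change |supportedConv f j - _| ≤ _
  cases j with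
  | zero => simp; positivity
  | succ j =>
    rw [PowerSeries.coeff_succ_X_mul, PowerSeries.coeff_mul]
    simp only [PowerSeries.coeff_mk]
    change |supportedConv f (j + 1) - _ * supportedConv f j| ≤ _
    refine (abs_sub _ _).trans ?_
    simp [abs_mul]

/-- The pairs of monic polynomials `(h, f)` of degrees `a` and `n` such that every prime factor
of `h` divides `f`. -/
noncomputable def supportedPairs (F : Type) [Field F] [Fintype F] (a n : ℕ) :
    Finset (F[X] × F[X]) :=
  (Mn F a ×ˢ Mn F n).filter (fun x => ∃ k : ℕ, x.1 ∣ x.2 ^ k)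

theorem mem_supportedPairs {a n : ℕ} {x : F[X] × F[X]} :
    x ∈ supportedPairs F a n ↔ ((x.1.Monic ∧ x.1.natDegree = a) ∧
      x.2.Monic ∧ x.2.natDegree = n) ∧ ∃ k : ℕ, x.1 ∣ x.2 ^ k := by
  simp [supportedPairs, mem_Mn]

theorem sum_card_supportedMn (a n : ℕ) :
    ∑ f ∈ Mn F n, (supportedMn f a).card = (supportedPairs F a n).card := by
  simp_rw [supportedPairs, supportedMn, Finset.card_filter]
  rw [Finset.sum_product_right]

theorem card_supportedPairs_le (a n : ℕ) :
    ((supportedPairs F a n).card : ℝ) ≤ 4 ^ a * (Fintype.card F : ℝ) ^ n := by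
  induction a using Nat.strong_induction_on generalizing n with
  | _ a ih =>
    rcases Nat.eq_zero_or_pos a with rfl | ha
    · refine (Nat.cast_le.2 (Finset.card_filter_le _ _)).trans ?_
      rw [Finset.card_product, card_Mn, card_Mn]
      simp
    set I := (Finset.Icc 1 n ×ˢ Finset.Icc 1 a).filter (fun p => p.1 * p.2 ≤ a) with hI
    have hsub : supportedPairs F a n ⊆ I.biUnion fun p =>
        (Mn F p.1 ×ˢ supportedPairs F (a - p.1 * p.2) (n - p.1)).image
          fun y => (y.1 ^ p.2 * y.2.1, y.1 * y.2.2) := by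
      rintro ⟨h, f⟩ hx
      obtain ⟨⟨⟨hh, hha⟩, hf, hfn⟩, hs⟩ := mem_supportedPairs.1 hx
      dsimp only at hh hha hf hfn hs
      have h1 : h ≠ 1 := by
        rintro rfl
        simp at hha
        omega
      obtain ⟨P, h', f', k, hP, hh', hf', hPd, hk, rfl, rfl, hs'⟩ :=
        exists_prime_pow_mul_of_supported hh hf h1 hs
      rw [(hP.pow k).natDegree_mul hh', hP.natDegree_pow] at hha
      rw [hP.natDegree_mul hf'] at hfn
      have hkd : k ≤ k * P.natDegree := Nat.le_mul_of_pos_right _ hPd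
      rw [mul_comm] at hha hkd
      refine Finset.mem_biUnion.2 ⟨(P.natDegree, k), ?_, ?_⟩
      · simp only [hI, Finset.mem_filter, Finset.mem_product, Finset.mem_Icc]
        omega
      · refine Finset.mem_image.2 ⟨(P, h', f'), ?_, rfl⟩
        simp only [Finset.mem_product, mem_Mn, mem_supportedPairs]
        exact ⟨⟨hP, trivial⟩, ⟨⟨hh', by omega⟩, hf', by omega⟩, hs'⟩
    have hterm : ∀ p ∈ I, (((Mn F p.1 ×ˢ supportedPairs F (a - p.1 * p.2) (n - p.1)).image
          fun y => (y.1 ^ p.2 * y.2.1, y.1 * y.2.2)).card : ℝ) ≤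
        4 ^ a * (Fintype.card F : ℝ) ^ n * ((1 / 2) ^ p.1 * (1 / 2) ^ p.2) := by
      rintro ⟨d, k⟩ hp
      simp only [hI, Finset.mem_filter, Finset.mem_product, Finset.mem_Icc] at hp
      obtain ⟨⟨⟨hd, hdn⟩, hk, -⟩, hdk⟩ := hp
      have hpos : 0 < d * k := by positivity
      refine (Nat.cast_le.2 Finset.card_image_le).trans ?_
      rw [Finset.card_product, card_Mn]
      push_cast
      refine (mul_le_mul_of_nonneg_left (ih (a - d * k) (by omega) (n - d))
        (by positivity)).trans ?_
      have h4 : (4 : ℝ) ^ (a - d * k) ≤ 4 ^ a * ((1 / 2) ^ d * (1 / 2) ^ k) := by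
        have h4a : (4 : ℝ) ^ a = 4 ^ (a - d * k) * 2 ^ (2 * (d * k)) := by
          rw [pow_mul, show (2 : ℝ) ^ 2 = 4 by norm_num, ← pow_add, Nat.sub_add_cancel hdk]
        have h2 : (2 : ℝ) ^ (d + k) ≤ 2 ^ (2 * (d * k)) :=
          pow_le_pow_right₀ one_le_two (by nlinarith)
        rw [h4a, ← pow_add, one_div, inv_pow, ← div_eq_mul_inv, le_div_iff₀ (by positivity)]
        gcongr
      have hq : (Fintype.card F : ℝ) ^ n = Fintype.card F ^ d * Fintype.card F ^ (n - d) := by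
        rw [← pow_add, Nat.add_sub_cancel' hdn]
      calc (Fintype.card F : ℝ) ^ d * (4 ^ (a - d * k) * Fintype.card F ^ (n - d))
          = 4 ^ (a - d * k) * Fintype.card F ^ n := by rw [hq]; ring
        _ ≤ 4 ^ a * ((1 / 2) ^ d * (1 / 2) ^ k) * Fintype.card F ^ n := by gcongr
        _ = _ := by ring
    have hhalf : ∀ m : ℕ, ∑ i ∈ Finset.Icc 1 m, (1 / 2 : ℝ) ^ i ≤ 1 := fun m => by
      have : ∑ i ∈ Finset.Icc 1 m, (1 / 2 : ℝ) ^ i = 1 - (1 / 2) ^ m := by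
        induction m with
        | zero => simp
        | succ m ihm =>
          rw [Finset.sum_Icc_succ_top (by omega), ihm, pow_succ]
          ring
      rw [this]
      have : (0 : ℝ) ≤ (1 / 2) ^ m := by positivity
      linarith
    calc ((supportedPairs F a n).card : ℝ)
        ≤ ∑ p ∈ I, (((Mn F p.1 ×ˢ supportedPairs F (a - p.1 * p.2) (n - p.1)).image
          fun y => (y.1 ^ p.2 * y.2.1, y.1 * y.2.2)).card : ℝ) := by
          exact_mod_cast (Finset.card_le_card hsub).trans Finset.card_biUnion_le
      _ ≤ ∑ p ∈ I, 4 ^ a * (Fintype.card F : ℝ) ^ n * ((1 / 2) ^ p.1 * (1 / 2) ^ p.2) :=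
          Finset.sum_le_sum hterm
      _ ≤ ∑ p ∈ Finset.Icc 1 n ×ˢ Finset.Icc 1 a,
            4 ^ a * (Fintype.card F : ℝ) ^ n * ((1 / 2) ^ p.1 * (1 / 2) ^ p.2) :=
          Finset.sum_le_sum_of_subset_of_nonneg (Finset.filter_subset _ _)
            fun _ _ _ => by positivity
      _ = 4 ^ a * (Fintype.card F : ℝ) ^ n * ((∑ i ∈ Finset.Icc 1 n, (1 / 2) ^ i) *
            ∑ i ∈ Finset.Icc 1 a, (1 / 2) ^ i) := by
          rw [← Finset.mul_sum, Finset.sum_product, Finset.sum_mul_sum]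
      _ ≤ 4 ^ a * (Fintype.card F : ℝ) ^ n * 1 := by
          gcongr
          exact mul_le_one₀ (hhalf n) (Finset.sum_nonneg fun _ _ => by positivity) (hhalf a)
      _ = _ := mul_one _

theorem sum_range_ite_pow_le {x : ℝ} (hx : 2 ≤ x) (n m : ℕ) :
    ∑ i ∈ Finset.range m, (if n ≤ 2 * i + 1 then 0 else x ^ (2 * i)) ≤ x ^ min n (2 * m) := by
  have hx1 : 1 ≤ x := by linarith
  induction m with
  | zero => simp
  | succ m ih =>
    rw [Finset.sum_range_succ]
    split_ifs with h
    · rw [add_zero]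
      exact ih.trans (pow_le_pow_right₀ hx1 (by omega))
    · rw [min_eq_right (by omega)] at ih ⊢
      have : (0 : ℝ) ≤ x ^ (2 * m) := by positivity
      calc _ ≤ x ^ (2 * m) + x ^ (2 * m) := by gcongr
        _ ≤ x ^ (2 * m) * (x * x) := by
          rw [← mul_two]
          gcongr
          nlinarith
        _ = x ^ (2 * (m + 1)) := by ring

theorem sum_range_pow_le {x : ℝ} (hx : 2 ≤ x) (m : ℕ) :
    ∑ i ∈ Finset.range m, x ^ i ≤ x ^ m := by
  induction m with
  | zero => simp
  | succ m ih =>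
    have : (0 : ℝ) ≤ x ^ m := by positivity
    rw [Finset.sum_range_succ, pow_succ]
    nlinarith

theorem abs_supportedConv_le {f : F[X]} (h2 : ringChar F ≠ 2) (hf : f.Monic)
    (hsq : ¬IsSquare f) (j : ℕ) :
    |(supportedConv f j : ℝ)| ≤ ∑ p ∈ Finset.HasAntidiagonal.antidiagonal j,
      ((supportedMn f p.1).card : ℝ) *
        (if f.natDegree ≤ 2 * p.2 + 1 then 0 else (Fintype.card F : ℝ) ^ (2 * p.2 + 1)) := by
  rw [supportedConv]
  push_cast
  refine (Finset.abs_sum_le_sum_abs _ _).trans (Finset.sum_le_sum fun p _ => ?_)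
  rw [abs_mul, Nat.abs_cast]
  refine mul_le_mul_of_nonneg_left ?_ (Nat.cast_nonneg _)
  split_ifs with h
  · rw [← Int.cast_sum, sum_jacobiP_eq_zero h2 hf hsq h]
    simp
  · refine (Finset.abs_sum_le_sum_abs _ _).trans ?_
    refine (Finset.sum_le_card_nsmul _ _ 1 fun B _ => ?_).trans ?_
    · exact_mod_cast abs_jacobiP_le_one hf.ne_zero B
    · simp [card_Mn]

theorem sum_abs_supportedConv_le (h2 : ringChar F ≠ 2) (hq : 4 ≤ Fintype.card F) (n j : ℕ) :
    ∑ f ∈ (Mn F n).filter (fun f => ¬IsSquare f), |(supportedConv f j : ℝ)| ≤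
      (Fintype.card F : ℝ) ^ n *
        (Fintype.card F * 4 ^ j * ((Fintype.card F : ℝ) / 2) ^ n) := by
  set q : ℝ := (Fintype.card F : ℝ) with hqdef
  have hq4 : 4 ≤ q := by rw [hqdef]; exact_mod_cast hq
  have hx : 2 ≤ q / 2 := by linarith
  calc ∑ f ∈ (Mn F n).filter (fun f => ¬IsSquare f), |(supportedConv f j : ℝ)|
      ≤ ∑ f ∈ (Mn F n).filter (fun f => ¬IsSquare f),
          ∑ p ∈ Finset.HasAntidiagonal.antidiagonal j, ((supportedMn f p.1).card : ℝ) *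
            (if n ≤ 2 * p.2 + 1 then 0 else q ^ (2 * p.2 + 1)) := by
        refine Finset.sum_le_sum fun f hf => ?_
        obtain ⟨hfn, hsq⟩ := Finset.mem_filter.1 hf
        obtain ⟨hfm, rfl⟩ := mem_Mn.1 hfn
        exact abs_supportedConv_le h2 hfm hsq j
    _ ≤ ∑ f ∈ Mn F n, ∑ p ∈ Finset.HasAntidiagonal.antidiagonal j,
          ((supportedMn f p.1).card : ℝ) *
            (if n ≤ 2 * p.2 + 1 then 0 else q ^ (2 * p.2 + 1)) := by
        refine Finset.sum_le_sum_of_subset_of_nonneg (Finset.filter_subset _ _)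
          fun _ _ _ => Finset.sum_nonneg fun _ _ => ?_
        split_ifs <;> positivity
    _ = ∑ p ∈ Finset.HasAntidiagonal.antidiagonal j, ((supportedPairs F p.1 n).card : ℝ) *
            (if n ≤ 2 * p.2 + 1 then 0 else q ^ (2 * p.2 + 1)) := by
        rw [Finset.sum_comm]
        refine Finset.sum_congr rfl fun p _ => ?_
        rw [← Finset.sum_mul, ← sum_card_supportedMn]
        push_cast
        rfl
    _ ≤ ∑ p ∈ Finset.HasAntidiagonal.antidiagonal j,
          q ^ n * (q * 4 ^ j * (if n ≤ 2 * p.2 + 1 then 0 else (q / 2) ^ (2 * p.2))) := by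
        refine Finset.sum_le_sum fun p hp => ?_
        obtain rfl := Finset.HasAntidiagonal.mem_antidiagonal.1 hp
        split_ifs
        · simp
        · refine (mul_le_mul_of_nonneg_right (card_supportedPairs_le p.1 n)
            (by positivity)).trans_eq ?_
          rw [← hqdef, div_pow, pow_mul 2, show (2 : ℝ) ^ 2 = 4 by norm_num, pow_add 4]
          field_simp
          ring
    _ = q ^ n * (q * 4 ^ j * ∑ i ∈ Finset.range (j + 1),
          (if n ≤ 2 * i + 1 then 0 else (q / 2) ^ (2 * i))) := by
        rw [← Finset.mul_sum, ← Finset.mul_sum,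
          ← Finset.Nat.sum_antidiagonal_eq_sum_range_succ
            (fun i _ => if n ≤ 2 * i + 1 then (0 : ℝ) else (q / 2) ^ (2 * i)),
          ← Finset.Nat.sum_antidiagonal_swap]
        rfl
    _ ≤ q ^ n * (q * 4 ^ j * (q / 2) ^ n) := by
        gcongr
        exact (sum_range_ite_pow_le hx n (j + 1)).trans
          (pow_le_pow_right₀ (by linarith) (min_le_left _ _))

end

/-- For fixed `𝔽_q` with `q ≡ 1 (mod 4)`, the contribution of non-square `f`:
`∑_{D ∈ H_{2g+1,q}} ∑_{n=0}^{g} q^{-n} ∑_{f monic, deg f = n, f ≠ □} χ_D(f) = O((2q)^g)`. -/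
theorem nonsquare_contribution (F : Type) [Field F] [Fintype F]
    (h4 : Fintype.card F % 4 = 1) :
    ∃ C : ℝ, 0 < C ∧ ∀ g : ℕ,
      |∑ D ∈ (Mn F (2 * g + 1)).filter (fun D => Squarefree D),
          ∑ n ∈ Finset.range (g + 1), (Fintype.card F : ℝ) ^ (-(n : ℤ)) *
            ∑ f ∈ (Mn F n).filter (fun f => ¬IsSquare f), (jacobiP D f : ℝ)|
        ≤ C * (2 * (Fintype.card F : ℝ)) ^ g := by
  have hchar : ringChar F ≠ 2 := by
    rw [Ne, FiniteField.even_card_iff_char_two]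
    omega
  have hcard : 4 ≤ Fintype.card F := by
    have := Fintype.one_lt_card (α := F)
    omega
  set q : ℝ := (Fintype.card F : ℝ) with hq
  have hq4 : 4 ≤ q := by rw [hq]; exact_mod_cast hcard
  refine ⟨q * (1 + q) * (q / 2), by positivity, fun g => ?_⟩
  change |∑ D ∈ squarefreeMn F (2 * g + 1), _| ≤ _
  have hterm : ∀ n : ℕ, |q ^ (-(n : ℤ)) * ∑ f ∈ (Mn F n).filter (fun f => ¬IsSquare f),
      ∑ D ∈ squarefreeMn F (2 * g + 1), (jacobiP D f : ℝ)| ≤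
        q * (1 + q) * 4 ^ g * (q / 2) ^ n := by
    intro n
    have hqn : 0 < q ^ n := by positivity
    rw [abs_mul, zpow_neg, zpow_natCast, abs_of_pos (inv_pos.2 hqn), inv_mul_le_iff₀ hqn]
    refine (Finset.abs_sum_le_sum_abs _ _).trans ?_
    calc ∑ f ∈ (Mn F n).filter (fun f => ¬IsSquare f),
          |∑ D ∈ squarefreeMn F (2 * g + 1), (jacobiP D f : ℝ)|
        ≤ ∑ f ∈ (Mn F n).filter (fun f => ¬IsSquare f),
            (|(supportedConv f g : ℝ)| + q * |(supportedConv f (g - 1) : ℝ)|) := by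
          refine Finset.sum_le_sum fun f hf => ?_
          have hfm := (mem_Mn.1 (Finset.mem_filter.1 hf).1).1
          rw [hq]
          exact_mod_cast abs_sum_squarefree_jacobiP_le hfm.ne_zero g
      _ ≤ q ^ n * (q * 4 ^ g * (q / 2) ^ n) + q * (q ^ n * (q * 4 ^ (g - 1) * (q / 2) ^ n)) := by
          rw [Finset.sum_add_distrib, ← Finset.mul_sum]
          gcongr
          · exact sum_abs_supportedConv_le hchar hcard n g
          · exact sum_abs_supportedConv_le hchar hcard n (g - 1)
      _ ≤ q ^ n * (q * 4 ^ g * (q / 2) ^ n) + q * (q ^ n * (q * 4 ^ g * (q / 2) ^ n)) := by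
          gcongr
          · norm_num
          · omega
      _ = q ^ n * (q * (1 + q) * 4 ^ g * (q / 2) ^ n) := by ring
  calc |∑ D ∈ squarefreeMn F (2 * g + 1), ∑ n ∈ Finset.range (g + 1), q ^ (-(n : ℤ)) *
          ∑ f ∈ (Mn F n).filter (fun f => ¬IsSquare f), (jacobiP D f : ℝ)|
      = |∑ n ∈ Finset.range (g + 1), q ^ (-(n : ℤ)) *
          ∑ f ∈ (Mn F n).filter (fun f => ¬IsSquare f),
            ∑ D ∈ squarefreeMn F (2 * g + 1), (jacobiP D f : ℝ)| := by
        rw [Finset.sum_comm]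
        congr 1
        refine Finset.sum_congr rfl fun n _ => ?_
        rw [← Finset.mul_sum, Finset.sum_comm]
    _ ≤ ∑ n ∈ Finset.range (g + 1), q * (1 + q) * 4 ^ g * (q / 2) ^ n :=
        (Finset.abs_sum_le_sum_abs _ _).trans (Finset.sum_le_sum fun n _ => hterm n)
    _ ≤ q * (1 + q) * 4 ^ g * (q / 2) ^ (g + 1) := by
        rw [← Finset.mul_sum]
        gcongr
        exact sum_range_pow_le (by linarith) _
    _ = q * (1 + q) * (q / 2) * (2 * q) ^ g := by
        have h : (4 : ℝ) ^ g * (q / 2) ^ g = (2 * q) ^ g := by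
          rw [← mul_pow]
          ring
        rw [← h]
        ring
end

section
/- Fix a finite field F_q with q ≡ 1 mod 4. Then as g → ∞, (1/#H_{2g+1,q}) * sum over D in H_{2g+1,q} of L(1, chi_D) tends to zeta_A(2) * P(2), where P(s) = prod over monic irreducible P of (1 - 1/((|P|+1)|P|^s)) and zeta_A(2) = 1/(1 - q^{-1}). -/
open Polynomial UniqueFactorizationMonoid
open scoped Classical

namespace QuadraticMean

open Filter Topology

section Field

variable {F : Type} [Field F]

theorem exists_monic_gcd {f g : F[X]} (hf : f.Monic) (hg : g.Monic) :
    ∃ d x y : F[X], d.Monic ∧ x.Monic ∧ y.Monic ∧ f = d * x ∧ g = d * y ∧ IsCoprime x y := by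
  have hd0 : EuclideanDomain.gcd f g ≠ 0 := fun h => hf.ne_zero (EuclideanDomain.gcd_eq_zero_iff.1 h).1
  set d := normalize (EuclideanDomain.gcd f g) with hd
  have hdm : d.Monic := monic_normalize hd0
  obtain ⟨x, hx⟩ : d ∣ f := normalize_dvd_iff.2 (EuclideanDomain.gcd_dvd_left f g)
  obtain ⟨y, hy⟩ : d ∣ g := normalize_dvd_iff.2 (EuclideanDomain.gcd_dvd_right f g)
  refine ⟨d, x, y, hdm, hdm.of_mul_monic_left (hx ▸ hf), hdm.of_mul_monic_left (hy ▸ hg),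
    hx, hy, ?_⟩
  obtain ⟨u, hu⟩ : Associated (EuclideanDomain.gcd f g) d := associated_normalize _
  refine ⟨EuclideanDomain.gcdA f g * u, EuclideanDomain.gcdB f g * u, ?_⟩
  have hab := EuclideanDomain.gcd_eq_gcd_ab f g
  apply mul_left_cancel₀ hdm.ne_zero
  linear_combination (-(u : F[X]) * hab + hu - EuclideanDomain.gcdA f g * u * hx -
    EuclideanDomain.gcdB f g * u * hy)

theorem exists_monic_sq {x : F[X]} (hx : x.Monic) {a : F[X]} (h : Associated (a ^ 2) x) :
    ∃ b : F[X], b.Monic ∧ x = b ^ 2 := by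
  have ha : a ≠ 0 := by
    rintro rfl
    simp at h
    exact hx.ne_zero ((associated_zero_iff_eq_zero x).1 h.symm)
  refine ⟨normalize a, monic_normalize ha, ?_⟩
  have := normalize_eq_normalize_iff_associated.2 h
  rw [hx.normalize_eq_self, sq, normalize_mul, ← sq] at this
  exact this.symm

theorem exists_monic_of_isSquare {x : F[X]} (hx : x.Monic) (h : IsSquare x) :
    ∃ b : F[X], b.Monic ∧ x = b ^ 2 := by
  obtain ⟨a, ha⟩ := h
  exact exists_monic_sq hx (a := a) (by rw [ha, sq])

/-- Monic irreducible polynomials. -/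
abbrev MonicPrime (F : Type) [Field F] : Type := {P : F[X] // P.Monic ∧ Irreducible P}

theorem exists_sq_mul_squarefree {D : F[X]} (hD : D.Monic) :
    ∃ l E : F[X], l.Monic ∧ E.Monic ∧ Squarefree E ∧ D = l ^ 2 * E := by
  induction hn : D.natDegree using Nat.strong_induction_on generalizing D with
  | _ n ih =>
    by_cases hsq : Squarefree D
    · exact ⟨1, D, monic_one, hD, hsq, by ring⟩
    · rw [Squarefree] at hsq
      push Not at hsq
      obtain ⟨x, hxD, hx⟩ := hsq
      have hx0 : x ≠ 0 := by
        rintro rfl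
        exact hD.ne_zero (by simpa using hxD)
      have hm : (normalize x).Monic := monic_normalize hx0
      have hass : Associated x (normalize x) := associated_normalize x
      obtain ⟨D', hD'⟩ := ((hass.mul_mul hass).dvd_iff_dvd_left).1 hxD
      have hm' : D'.Monic := (hm.mul hm).of_mul_monic_left (hD' ▸ hD)
      have hpos : 0 < (normalize x).natDegree := by
        rw [Nat.pos_iff_ne_zero]
        intro h0
        have := (hm.natDegree_eq_zero).1 h0
        exact hx (hass.isUnit_iff.2 (this ▸ isUnit_one))
      have hdeg : D.natDegree = (normalize x).natDegree + (normalize x).natDegree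
          + D'.natDegree := by
        rw [hD', (hm.mul hm).natDegree_mul hm', hm.natDegree_mul hm]
      obtain ⟨l, E, hl, hE, hEs, rfl⟩ := ih D'.natDegree (by omega) hm' rfl
      exact ⟨normalize x * l, E, hm.mul hl, hE, hEs, by rw [hD']; ring⟩

theorem sq_mul_squarefree_unique {l m E E' : F[X]} (hl : l.Monic) (hm : m.Monic)
    (hE : Squarefree E) (hE' : Squarefree E') (h : l ^ 2 * E = m ^ 2 * E') :
    l = m ∧ E = E' := by
  obtain ⟨d, x, y, hd, hx, hy, rfl, rfl, hxy⟩ := exists_monic_gcd hl hm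
  have h' : x ^ 2 * E = y ^ 2 * E' := by
    apply mul_left_cancel₀ (pow_ne_zero 2 hd.ne_zero)
    linear_combination h
  have hx1 : x = 1 := by
    have h1 : x ^ 2 ∣ E' := (hxy.pow (m := 2) (n := 2)).dvd_of_dvd_mul_left ⟨E, h'.symm⟩
    exact hx.eq_one_of_isUnit (hE' x (by rwa [← sq]))
  have hy1 : y = 1 := by
    have h1 : y ^ 2 ∣ E := (hxy.symm.pow (m := 2) (n := 2)).dvd_of_dvd_mul_left ⟨E', h'⟩
    exact hy.eq_one_of_isUnit (hE y (by rwa [← sq]))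
  subst hx1 hy1
  exact ⟨rfl, by simpa using h'⟩

/-- The monic irreducible factors of `f`. -/
noncomputable def primesOf (f : F[X]) : Finset (MonicPrime F) :=
  (normalizedFactors f).toFinset.subtype _

theorem mem_primesOf {f : F[X]} (hf : f ≠ 0) {P : MonicPrime F} :
    P ∈ primesOf f ↔ P.1 ∣ f := by
  rw [primesOf, Finset.mem_subtype, Multiset.mem_toFinset, mem_normalizedFactors_iff' hf]
  exact ⟨fun h => h.2.2, fun h => ⟨P.2.2, P.2.1.normalize_eq_self, h⟩⟩

theorem exists_mem_normalizedFactors_iff {f : F[X]} (p : F[X] → Prop) :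
    (∃ P ∈ normalizedFactors f, p P) ↔ ∃ P ∈ primesOf f, p P.1 := by
  constructor
  · rintro ⟨P, hP, h⟩
    have hi := irreducible_of_normalized_factor P hP
    have hm : P.Monic := by
      rw [← normalize_normalized_factor P hP]
      exact monic_normalize hi.ne_zero
    exact ⟨⟨P, hm, hi⟩, by rwa [primesOf, Finset.mem_subtype, Multiset.mem_toFinset], h⟩
  · rintro ⟨P, hP, h⟩
    exact ⟨P.1, by rwa [primesOf, Finset.mem_subtype, Multiset.mem_toFinset] at hP, h⟩

theorem primesOf_sq {f : F[X]} (hf : f ≠ 0) : primesOf (f ^ 2) = primesOf f := by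
  ext P
  rw [mem_primesOf (pow_ne_zero 2 hf), mem_primesOf hf, P.2.2.prime.dvd_pow_iff_dvd two_ne_zero]

theorem monic_prod_monicPrime (s : Finset (MonicPrime F)) : (∏ P ∈ s, P.1).Monic :=
  monic_prod_of_monic _ _ fun P _ => P.2.1

theorem subset_primesOf_iff {s : Finset (MonicPrime F)} {l : F[X]} (hl : l ≠ 0) :
    s ⊆ primesOf l ↔ ∏ P ∈ s, P.1 ∣ l := by
  constructor
  · intro h
    refine Finset.prod_dvd_of_isRelPrime (fun P _ R _ hPR => ?_)
      fun P hP => (mem_primesOf hl).1 (h hP)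
    refine P.2.2.isRelPrime_iff_not_dvd.2 fun hd => hPR ?_
    exact Subtype.ext (eq_of_monic_of_associated P.2.1 R.2.1 (P.2.2.associated_of_dvd R.2.2 hd))
  · intro h P hP
    exact (mem_primesOf hl).2 ((Finset.dvd_prod_of_mem _ hP).trans h)

end Field

variable {F : Type} [Field F] [Fintype F]

theorem mem_Mn {n : ℕ} {f : F[X]} : f ∈ Mn F n ↔ f.Monic ∧ f.natDegree = n := by
  simp [Mn]

theorem card_Mn (n : ℕ) : (Mn F n).card = Fintype.card F ^ n := by
  have : (Finset.univ : Finset (Fin n → F)).card = (Mn F n).card := by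
    refine Finset.card_bij (fun c _ => X ^ n + ∑ i : Fin n, C (c i) * X ^ (i : ℕ)) ?_ ?_ ?_
    · intro c _
      have hdeg : (∑ i : Fin n, C (c i) * X ^ (i : ℕ)).degree < (n : WithBot ℕ) := by
        refine (Polynomial.degree_sum_fin_lt c)
      rw [mem_Mn]
      exact ⟨monic_X_pow_add hdeg, by rw [natDegree_add_eq_left_of_degree_lt
        (by simpa using hdeg), natDegree_X_pow]⟩
    · intro c _ d _ h
      have h' := add_left_cancel h
      funext i
      have := congrArg (fun p => p.coeff (i : ℕ)) h'
      simpa [Polynomial.finsetSum_coeff, coeff_C_mul, coeff_X_pow, Fin.val_inj] using this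
    · intro f hf
      obtain ⟨hm, rfl⟩ := mem_Mn.1 hf
      refine ⟨fun i => f.coeff i, Finset.mem_univ _, ?_⟩
      dsimp only
      rw [Fin.sum_univ_eq_sum_range (fun i => C (f.coeff i) * X ^ i) f.natDegree]
      exact hm.as_sum.symm
  rw [← this]
  simp

theorem mul_mem_Mn {m n : ℕ} {f g : F[X]} (hf : f ∈ Mn F m) (hg : g ∈ Mn F n) :
    f * g ∈ Mn F (m + n) := by
  obtain ⟨h1, rfl⟩ := mem_Mn.1 hf
  obtain ⟨h2, rfl⟩ := mem_Mn.1 hg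
  exact mem_Mn.2 ⟨h1.mul h2, h1.natDegree_mul h2⟩

theorem jacobiP_mul_right (D : F[X]) {f g : F[X]} (hf : f ≠ 0) (hg : g ≠ 0) :
    jacobiP D (f * g) = jacobiP D f * jacobiP D g := by
  simp [jacobiP, normalizedFactors_mul hf hg]

theorem jacobiP_irreducible (D : F[X]) {P : F[X]} (hP : Irreducible P) (hm : P.Monic) :
    jacobiP D P = legP D P := by
  simp [jacobiP, normalizedFactors_irreducible hP, hm.normalize_eq_self]

theorem jacobiP_one_right (D : F[X]) : jacobiP D 1 = 1 := by simp [jacobiP]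

theorem legP_congr {D E P : F[X]} (h : P ∣ D - E) : legP D P = legP E P := by
  have h1 : P ∣ D ↔ P ∣ E := (dvd_iff_dvd_of_dvd_sub h)
  have h2 : Ideal.Quotient.mk (Ideal.span {P}) D = Ideal.Quotient.mk (Ideal.span {P}) E := by
    rw [Ideal.Quotient.eq, Ideal.mem_span_singleton]; exact h
  simp only [legP, h1, h2]

theorem finite_quotient {P : F[X]} (hP : P ≠ 0) : Finite (F[X] ⧸ Ideal.span {P}) := by
  have := (AdjoinRoot.powerBasis hP).finite
  exact Module.finite_of_finite F (M := AdjoinRoot P)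

theorem legP_mul {P : F[X]} (hP : Irreducible P) (D E : F[X]) :
    legP (D * E) P = legP D P * legP E P := by
  have : (Ideal.span {P}).IsMaximal := PrincipalIdealRing.isMaximal_of_irreducible hP
  let : Field (F[X] ⧸ Ideal.span {P}) := Ideal.Quotient.field _
  have := finite_quotient hP.ne_zero
  let := Fintype.ofFinite (F[X] ⧸ Ideal.span {P})
  have key : ∀ D : F[X], legP D P =
      quadraticCharFun (F[X] ⧸ Ideal.span {P}) (Ideal.Quotient.mk _ D) := by
    intro D
    simp only [legP, quadraticCharFun, Ideal.Quotient.eq_zero_iff_mem, Ideal.mem_span_singleton]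
    congr
  rw [key, key, key, map_mul, quadraticCharFun_mul]

theorem exists_legP_eq_neg_one (h4 : Fintype.card F % 4 = 1) {P : F[X]} (hP : Irreducible P) :
    ∃ c, legP c P = -1 := by
  have : (Ideal.span {P}).IsMaximal := PrincipalIdealRing.isMaximal_of_irreducible hP
  let : Field (F[X] ⧸ Ideal.span {P}) := Ideal.Quotient.field _
  have := finite_quotient hP.ne_zero
  let := Fintype.ofFinite (F[X] ⧸ Ideal.span {P})
  have hF : ringChar F ≠ 2 := by
    intro h; have := FiniteField.even_card_iff_char_two.1 h; omega
  have hc : ringChar (F[X] ⧸ Ideal.span {P}) ≠ 2 := by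
    rw [← Algebra.ringChar_eq F]; exact hF
  obtain ⟨a, ha⟩ := quadraticChar_exists_neg_one hc
  obtain ⟨c, rfl⟩ := Ideal.Quotient.mk_surjective a
  refine ⟨c, ?_⟩
  rw [quadraticChar_apply, quadraticCharFun] at ha
  rw [← ha]
  simp only [legP, Ideal.Quotient.eq_zero_iff_mem, Ideal.mem_span_singleton]
  congr

theorem jacobiP_mul_left (D E f : F[X]) :
    jacobiP (D * E) f = jacobiP D f * jacobiP E f := by
  rw [jacobiP, jacobiP, jacobiP, ← Multiset.prod_map_mul]
  exact congrArg _ (Multiset.map_congr rfl fun P hP =>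
    legP_mul (irreducible_of_normalized_factor P hP) D E)

theorem jacobiP_congr {D E f : F[X]} (h : f ∣ D - E) : jacobiP D f = jacobiP E f := by
  rw [jacobiP, jacobiP]
  exact congrArg _ (Multiset.map_congr rfl fun P hP =>
    legP_congr ((dvd_of_mem_normalizedFactors hP).trans h))

theorem legP_cases (D P : F[X]) : legP D P = 0 ∨ legP D P = 1 ∨ legP D P = -1 := by
  unfold legP; split_ifs <;> simp

theorem jacobiP_cases (D f : F[X]) : jacobiP D f = 0 ∨ jacobiP D f = 1 ∨ jacobiP D f = -1 := by
  unfold jacobiP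
  induction (normalizedFactors f) using Multiset.induction_on with
  | empty => simp
  | cons P s ih =>
    rw [Multiset.map_cons, Multiset.prod_cons]
    rcases legP_cases D P with h | h | h <;> rcases ih with h' | h' | h' <;> simp [h, h']

theorem abs_jacobiP_le_one (D f : F[X]) : |(jacobiP D f : ℝ)| ≤ 1 := by
  rcases jacobiP_cases D f with h | h | h <;> simp [h]

theorem jacobiP_eq_zero_iff {D f : F[X]} :
    jacobiP D f = 0 ↔ ∃ P ∈ normalizedFactors f, P ∣ D := by
  rw [jacobiP, Multiset.prod_eq_zero_iff, Multiset.mem_map]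
  refine exists_congr fun P => and_congr_right fun _ => ?_
  unfold legP; split_ifs <;> simp [*]

theorem jacobiP_mul_self (D : F[X]) {l : F[X]} (hl : l ≠ 0) :
    jacobiP D (l * l) = if ∃ P ∈ normalizedFactors l, P ∣ D then 0 else 1 := by
  rw [jacobiP_mul_right D hl hl]
  split_ifs with h
  · rw [jacobiP_eq_zero_iff.2 h, zero_mul]
  · rcases jacobiP_cases D l with h' | h' | h'
    · exact absurd (jacobiP_eq_zero_iff.1 h') h
    all_goals simp [h']

theorem jacobiP_one_left (f : F[X]) : jacobiP 1 f = 1 := by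
  refine Multiset.prod_eq_one fun x hx => ?_
  obtain ⟨P, hP, rfl⟩ := Multiset.mem_map.1 hx
  have hP := irreducible_of_normalized_factor P hP
  have : ¬ P ∣ 1 := fun h => hP.not_isUnit (isUnit_of_dvd_one h)
  simp [legP, this]

/-- A non-square modulus admits a coprime residue on which its Jacobi symbol is `-1`. -/
theorem exists_jacobiP_eq_neg_one (h4 : Fintype.card F % 4 = 1) {f : F[X]} (hf : f.Monic)
    (hsq : ¬ IsSquare f) : ∃ c, IsCoprime c f ∧ jacobiP c f = -1 := by
  have hodd : ∃ P ∈ normalizedFactors f, Odd ((normalizedFactors f).count P) := by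
    by_contra! hcon
    apply hsq
    have hprod : (normalizedFactors f).prod = f := by
      have := prod_normalizedFactors_eq (a := f) hf.ne_zero
      rwa [hf.normalize_eq_self] at this
    rw [← hprod, Finset.prod_multiset_count]
    refine ⟨∏ P ∈ (normalizedFactors f).toFinset, P ^ ((normalizedFactors f).count P / 2), ?_⟩
    rw [← Finset.prod_mul_distrib]
    refine Finset.prod_congr rfl fun P hP => ?_
    rw [← pow_add]
    have := Nat.not_odd_iff_even.1 (hcon P (Multiset.mem_toFinset.1 hP))
    obtain ⟨k, hk⟩ := this
    congr 1; omega
  obtain ⟨P, hPf, hk⟩ := hodd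
  have hP := irreducible_of_normalized_factor P hPf
  have hPm : P.Monic := by
    have := normalize_normalized_factor P hPf
    rw [← this]; exact monic_normalize hP.ne_zero
  set k := (normalizedFactors f).count P with hkdef
  have hfin : FiniteMultiplicity P f := FiniteMultiplicity.of_prime_left hP.prime hf.ne_zero
  obtain ⟨g, hfg, hg⟩ := hfin.exists_eq_pow_mul_and_not_dvd
  have hmul : multiplicity P f = k := by
    have h1 := emultiplicity_eq_count_normalizedFactors hP hf.ne_zero
    rw [hPm.normalize_eq_self] at h1
    exact multiplicity_eq_of_emultiplicity_eq_some h1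
  rw [hmul] at hfg
  have hcop : IsCoprime P g := (hP.coprime_iff_not_dvd).2 hg
  obtain ⟨a, ha⟩ := exists_legP_eq_neg_one h4 hP
  obtain ⟨u, v, huv⟩ := hcop
  have hg0 : g ≠ 0 := by rintro rfl; exact hg (dvd_zero _)
  refine ⟨a * (v * g) + u * P, ?_⟩
  have hcP : P ∣ (a * (v * g) + u * P) - a :=
    ⟨u * (1 - a), by linear_combination a * huv⟩
  have hcg : g ∣ (a * (v * g) + u * P) - 1 :=
    ⟨v * (a - 1), by linear_combination huv⟩
  have hJ : jacobiP (a * (v * g) + u * P) f = -1 := by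
    rw [hfg, jacobiP_mul_right _ (pow_ne_zero _ hP.ne_zero) hg0, jacobiP_congr hcg,
      jacobiP_one_left, mul_one]
    have : ∀ j, jacobiP (a * (v * g) + u * P) (P ^ j) = (-1) ^ j := by
      intro j
      induction j with
      | zero => simp [jacobiP_one_right]
      | succ j ih =>
        rw [pow_succ, jacobiP_mul_right _ (pow_ne_zero _ hP.ne_zero) hP.ne_zero, ih,
          jacobiP_irreducible _ hP hPm, legP_congr hcP, ha, pow_succ]
    rw [this, hk.neg_one_pow]
  refine ⟨?_, hJ⟩
  have hne : jacobiP (a * (v * g) + u * P) f ≠ 0 := by rw [hJ]; norm_num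
  rw [Ne, jacobiP_eq_zero_iff] at hne
  push Not at hne
  refine isCoprime_of_prime_dvd (fun h => hf.ne_zero h.2) ?_
  intro z hz hzc hzf
  obtain ⟨p, hp, hzp⟩ := exists_mem_normalizedFactors_of_dvd hf.ne_zero hz.irreducible hzf
  exact hne p hp (hzp.symm.dvd.trans hzc)

/-- Orthogonality: a complete character sum for a non-square modulus vanishes. -/
theorem sum_jacobiP_eq_zero (h4 : Fintype.card F % 4 = 1) {f : F[X]} (hf : f.Monic)
    (hsq : ¬ IsSquare f) {M : ℕ} (hM : f.natDegree ≤ M) :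
    ∑ D ∈ Mn F M, (jacobiP D f : ℝ) = 0 := by
  obtain ⟨c, hc, hJ⟩ := exists_jacobiP_eq_neg_one h4 hf hsq
  set φ : F[X] → F[X] := fun D => D + ((c * D) %ₘ f - D %ₘ f) with hφ
  have hφd : ∀ D, f ∣ φ D - c * D := by
    intro D
    have h1 := modByMonic_add_div (c * D) f
    have h2 := modByMonic_add_div D f
    refine ⟨D /ₘ f - (c * D) /ₘ f, ?_⟩
    simp only [hφ]
    linear_combination h1 - h2
  have hmaps : Set.MapsTo φ (Mn F M) (Mn F M) := by
    intro D hD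
    obtain ⟨hDm, hDd⟩ := mem_Mn.1 hD
    have hlt : ((c * D) %ₘ f - D %ₘ f).degree < D.degree := by
      refine lt_of_lt_of_le ((degree_sub_le _ _).trans_lt
        (max_lt (degree_modByMonic_lt _ hf) (degree_modByMonic_lt _ hf))) ?_
      rw [degree_eq_natDegree hf.ne_zero, degree_eq_natDegree hDm.ne_zero, hDd]
      exact_mod_cast hM
    exact mem_Mn.2 ⟨hDm.add_of_left hlt, by
      rw [← hDd]; exact natDegree_add_eq_left_of_degree_lt hlt⟩
  have hinj : Set.InjOn φ (Mn F M) := by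
    intro D _ E _ h
    have h1 : f ∣ c * (D - E) := by
      have := dvd_sub (hφd E) (hφd D)
      rw [h] at this
      convert this using 1; ring
    have h2 : f ∣ D - E := hc.symm.dvd_of_dvd_mul_left h1
    have h3 : D %ₘ f = E %ₘ f := by
      rw [← sub_eq_zero, ← sub_modByMonic, (modByMonic_eq_zero_iff_dvd hf).2 h2]
    have h4 : (c * D) %ₘ f = (c * E) %ₘ f := by
      rw [← sub_eq_zero, ← sub_modByMonic, ← mul_sub, (modByMonic_eq_zero_iff_dvd hf).2 h1]
    simp only [hφ, h3, h4] at h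
    simpa using h
  have hsurj := Finset.surjOn_of_injOn_of_card_le φ hmaps hinj le_rfl
  have hsum : ∑ D ∈ Mn F M, (jacobiP (φ D) f : ℝ) = ∑ D ∈ Mn F M, (jacobiP D f : ℝ) :=
    Finset.sum_nbij φ hmaps hinj hsurj fun _ _ => rfl
  have hneg : ∀ D, (jacobiP (φ D) f : ℝ) = -(jacobiP D f : ℝ) := by
    intro D
    rw [jacobiP_congr (hφd D), jacobiP_mul_left, hJ]; push_cast; ring
  simp only [hneg, Finset.sum_neg_distrib] at hsum
  linarith

theorem card_isSquare_mul_le (n : ℕ) :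
    ((Mn F n ×ˢ Mn F n).filter fun p => IsSquare (p.1 * p.2)).card ≤
      (n + 1) * Fintype.card F ^ n := by
  have hsub : ((Mn F n ×ˢ Mn F n).filter fun p => IsSquare (p.1 * p.2)) ⊆
      (Finset.range (n / 2 + 1)).biUnion fun j =>
        (Mn F (n - 2 * j) ×ˢ (Mn F j ×ˢ Mn F j)).image
          fun t => (t.1 * t.2.1 ^ 2, t.1 * t.2.2 ^ 2) := by
    rintro ⟨f, g⟩ h
    simp only [Finset.mem_filter, Finset.mem_product, mem_Mn] at h
    obtain ⟨⟨⟨hf, hfn⟩, hg, hgn⟩, hsq⟩ := h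
    obtain ⟨d, x, y, hd, hx, hy, rfl, rfl, hxy⟩ := exists_monic_gcd hf hg
    obtain ⟨z, hz⟩ := hsq
    obtain ⟨w, rfl⟩ : d ∣ z := by
      have : d ^ 2 ∣ z ^ 2 := ⟨x * y, by rw [sq, ← hz]; ring⟩
      exact (IsIntegrallyClosed.pow_dvd_pow_iff two_ne_zero).1 this
    have hxyw : x * y = w ^ 2 := by
      apply mul_left_cancel₀ (pow_ne_zero 2 hd.ne_zero)
      linear_combination hz
    obtain ⟨a, ha⟩ := exists_associated_pow_of_mul_eq_pow' hxy hxyw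
    obtain ⟨b, hb⟩ := exists_associated_pow_of_mul_eq_pow' hxy.symm (by rw [mul_comm]; exact hxyw)
    obtain ⟨a, ham, rfl⟩ := exists_monic_sq hx ha
    obtain ⟨b, hbm, rfl⟩ := exists_monic_sq hy hb
    rw [hd.natDegree_mul (ham.pow 2), ham.natDegree_pow] at hfn
    rw [hd.natDegree_mul (hbm.pow 2), hbm.natDegree_pow] at hgn
    simp only [Finset.mem_biUnion, Finset.mem_range, Finset.mem_image, Finset.mem_product, mem_Mn]
    exact ⟨a.natDegree, by omega, ⟨d, a, b⟩, ⟨⟨hd, by dsimp only; omega⟩, ⟨ham, rfl⟩, hbm, by dsimp only; omega⟩, rfl⟩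
  refine (Finset.card_le_card hsub).trans (Finset.card_biUnion_le.trans ?_)
  calc _ ≤ ∑ j ∈ Finset.range (n / 2 + 1), Fintype.card F ^ n := by
        refine Finset.sum_le_sum fun j hj => Finset.card_image_le.trans ?_
        rw [Finset.card_product, Finset.card_product, card_Mn, card_Mn, ← pow_add, ← pow_add]
        have := Finset.mem_range.1 hj
        exact le_of_eq (by congr 1; omega)
    _ ≤ _ := by
        rw [Finset.sum_const, Finset.card_range, smul_eq_mul]
        exact Nat.mul_le_mul_right _ (by omega)

theorem card_mul_eq_mul_le (N : ℕ) :
    (((Mn F N ×ˢ Mn F N) ×ˢ (Mn F N ×ˢ Mn F N)).filter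
      fun p => p.1.1 * p.1.2 = p.2.1 * p.2.2).card ≤ (N + 1) * Fintype.card F ^ (2 * N) := by
  have hsub : (((Mn F N ×ˢ Mn F N) ×ˢ (Mn F N ×ˢ Mn F N)).filter
      fun p => p.1.1 * p.1.2 = p.2.1 * p.2.2) ⊆
      (Finset.range (N + 1)).biUnion fun j =>
        ((Mn F j ×ˢ Mn F (N - j)) ×ˢ (Mn F (N - j) ×ˢ Mn F j)).image
          fun t => ((t.1.1 * t.1.2, t.2.1 * t.2.2), (t.1.1 * t.2.1, t.1.2 * t.2.2)) := by
    rintro ⟨⟨D₁, D₂⟩, D₃, D₄⟩ h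
    simp only [Finset.mem_filter, Finset.mem_product, mem_Mn] at h
    obtain ⟨⟨⟨⟨h1, hn1⟩, h2, hn2⟩, ⟨h3, hn3⟩, h4, hn4⟩, heq⟩ := h
    obtain ⟨a, b, c, ha, hb, hc, rfl, rfl, hbc⟩ := exists_monic_gcd h1 h3
    have hmul : b * D₂ = c * D₄ := by
      apply mul_left_cancel₀ ha.ne_zero
      linear_combination heq
    obtain ⟨e, rfl⟩ : b ∣ D₄ := hbc.dvd_of_dvd_mul_left ⟨D₂, hmul.symm⟩
    have he := hb.of_mul_monic_left h4
    obtain rfl : D₂ = c * e := by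
      apply mul_left_cancel₀ hb.ne_zero
      linear_combination hmul
    rw [ha.natDegree_mul hb] at hn1
    rw [ha.natDegree_mul hc] at hn3
    rw [hb.natDegree_mul he] at hn4
    have hce : (c * e).natDegree = c.natDegree + e.natDegree := hc.natDegree_mul he
    simp only [Finset.mem_biUnion, Finset.mem_range, Finset.mem_image, Finset.mem_product, mem_Mn]
    exact ⟨a.natDegree, by omega, ⟨⟨a, b⟩, c, e⟩,
      ⟨⟨⟨ha, rfl⟩, hb, by dsimp only; omega⟩, ⟨hc, by dsimp only; omega⟩, he, by dsimp only; omega⟩,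
      rfl⟩
  refine (Finset.card_le_card hsub).trans (Finset.card_biUnion_le.trans ?_)
  calc _ ≤ ∑ j ∈ Finset.range (N + 1), Fintype.card F ^ (2 * N) := by
        refine Finset.sum_le_sum fun j hj => Finset.card_image_le.trans ?_
        rw [Finset.card_product, Finset.card_product, Finset.card_product, card_Mn, card_Mn,
          ← pow_add, ← pow_add, ← pow_add]
        have := Finset.mem_range.1 hj
        exact le_of_eq (by congr 1; omega)
    _ ≤ _ := by
        rw [Finset.sum_const, Finset.card_range, smul_eq_mul]

/-- The `n`-th coefficient of the `L`-polynomial of `χ_D`. -/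
noncomputable def charSum (n : ℕ) (D : F[X]) : ℝ := ∑ f ∈ Mn F n, (jacobiP D f : ℝ)

theorem abs_sum_jacobiP_le (M : ℕ) (f : F[X]) :
    |∑ D ∈ Mn F M, (jacobiP D f : ℝ)| ≤ (Fintype.card F : ℝ) ^ M := by
  refine (Finset.abs_sum_le_sum_abs _ _).trans
    ((Finset.sum_le_card_nsmul _ _ 1 fun D _ => abs_jacobiP_le_one D f).trans ?_)
  simp [card_Mn]

theorem sum_charSum_sq_le (h4 : Fintype.card F % 4 = 1) {n M : ℕ} (h : 2 * n ≤ M) :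
    ∑ D ∈ Mn F M, charSum n D ^ 2 ≤
      (Fintype.card F : ℝ) ^ M * ((n + 1) * (Fintype.card F : ℝ) ^ n) := by
  have hexp : ∑ D ∈ Mn F M, charSum n D ^ 2 =
      ∑ p ∈ Mn F n ×ˢ Mn F n, ∑ D ∈ Mn F M, (jacobiP D (p.1 * p.2) : ℝ) := by
    rw [Finset.sum_comm]
    refine Finset.sum_congr rfl fun D _ => ?_
    rw [charSum, sq, Finset.sum_mul_sum, Finset.sum_product]
    refine Finset.sum_congr rfl fun f hf => Finset.sum_congr rfl fun g hg => ?_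
    rw [jacobiP_mul_right D (mem_Mn.1 hf).1.ne_zero (mem_Mn.1 hg).1.ne_zero]
    push_cast; rfl
  have hcard := card_isSquare_mul_le (F := F) n
  rw [hexp]
  calc _ ≤ ∑ p ∈ Mn F n ×ˢ Mn F n,
        if IsSquare (p.1 * p.2) then (Fintype.card F : ℝ) ^ M else 0 := by
        refine Finset.sum_le_sum fun p hp => ?_
        obtain ⟨⟨h1, hn1⟩, h2, hn2⟩ := by simpa only [Finset.mem_product, mem_Mn] using hp
        split_ifs with hsq
        · exact (le_abs_self _).trans (abs_sum_jacobiP_le _ _)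
        · refine (sum_jacobiP_eq_zero h4 (h1.mul h2) hsq ?_).le
          rw [h1.natDegree_mul h2]; omega
    _ = (((Mn F n ×ˢ Mn F n).filter fun p => IsSquare (p.1 * p.2)).card : ℝ) *
        (Fintype.card F : ℝ) ^ M := by
        rw [← Finset.sum_filter, Finset.sum_const, nsmul_eq_mul]
    _ ≤ ((n + 1) * (Fintype.card F : ℝ) ^ n) * (Fintype.card F : ℝ) ^ M := by
        gcongr; exact_mod_cast hcard
    _ = _ := mul_comm _ _

theorem sq_sum_charSum_le (h4 : Fintype.card F % 4 = 1) {n M : ℕ} (h : 2 * n ≤ M)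
    (b : F[X] → ℝ) :
    (∑ D ∈ Mn F M, b D * charSum n D) ^ 2 ≤ (∑ D ∈ Mn F M, b D ^ 2) *
      ((Fintype.card F : ℝ) ^ M * ((n + 1) * (Fintype.card F : ℝ) ^ n)) :=
  (Finset.sum_mul_sq_le_sq_mul_sq _ _ _).trans
    (mul_le_mul_of_nonneg_left (sum_charSum_sq_le h4 h) (Finset.sum_nonneg fun _ _ => sq_nonneg _))

theorem sq_sum_subset_charSum_le (h4 : Fintype.card F % 4 = 1) {n N : ℕ} (h : 2 * n ≤ N)
    {H : Finset F[X]} (hH : H ⊆ Mn F N) :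
    (∑ D ∈ H, charSum n D) ^ 2 ≤ (n + 1) * (Fintype.card F : ℝ) ^ (2 * N + n) := by
  have h1 := sq_sum_charSum_le h4 h (fun D => if D ∈ H then 1 else 0)
  have h2 : ∑ D ∈ Mn F N, (if D ∈ H then (1 : ℝ) else 0) * charSum n D =
      ∑ D ∈ H, charSum n D := by
    simp only [ite_mul, one_mul, zero_mul]
    rw [← Finset.sum_filter, Finset.filter_mem_eq_inter, Finset.inter_eq_right.2 hH]
  have h3 : ∑ D ∈ Mn F N, (if D ∈ H then (1 : ℝ) else 0) ^ 2 ≤ (Fintype.card F : ℝ) ^ N := by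
    refine (Finset.sum_le_card_nsmul _ _ 1 fun D _ => ?_).trans ?_
    · split_ifs <;> simp
    · simp [card_Mn]
  rw [h2] at h1
  refine h1.trans ((mul_le_mul_of_nonneg_right h3 (by positivity)).trans (le_of_eq ?_))
  rw [pow_add, two_mul, pow_add]; ring

/-- The number of ways to write `E` as a product of two elements of `H`. -/
noncomputable def mulCount (H : Finset F[X]) (E : F[X]) : ℝ :=
  ((H ×ˢ H).filter fun p => p.1 * p.2 = E).card

theorem sum_mulCount_sq_le {N : ℕ} {H : Finset F[X]} (hH : H ⊆ Mn F N) :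
    ∑ E ∈ Mn F (2 * N), mulCount H E ^ 2 ≤ (N + 1) * (Fintype.card F : ℝ) ^ (2 * N) := by
  have key : ∑ E ∈ Mn F (2 * N), ((H ×ˢ H).filter fun p => p.1 * p.2 = E).card ^ 2 ≤
      (((Mn F N ×ˢ Mn F N) ×ˢ (Mn F N ×ˢ Mn F N)).filter
        fun p => p.1.1 * p.1.2 = p.2.1 * p.2.2).card := by
    rw [Finset.card_eq_sum_card_fiberwise (f := fun p => p.1.1 * p.1.2) (t := Mn F (2 * N))]
    · refine Finset.sum_le_sum fun E _ => ?_
      rw [sq, ← Finset.card_product]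
      refine Finset.card_le_card ?_
      rintro ⟨⟨D₁, D₂⟩, D₃, D₄⟩ h
      simp only [Finset.mem_filter, Finset.mem_product] at h ⊢
      obtain ⟨⟨⟨h1, h2⟩, h12⟩, ⟨h3, h4⟩, h34⟩ := h
      exact ⟨⟨⟨⟨hH h1, hH h2⟩, hH h3, hH h4⟩, by rw [h12, h34]⟩, h12⟩
    · rintro ⟨⟨D₁, D₂⟩, D₃, D₄⟩ h
      simp only [Finset.coe_filter, Finset.mem_product, Set.mem_ofPred_eq] at h
      rw [two_mul]
      exact mul_mem_Mn h.1.1.1 h.1.1.2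
  have := key.trans (card_mul_eq_mul_le N)
  unfold mulCount
  exact_mod_cast this

theorem pow_four_sum_subset_charSum_le (h4 : Fintype.card F % 4 = 1) {n N : ℕ} (h : n ≤ N)
    {H : Finset F[X]} (hH : H ⊆ Mn F N) :
    (∑ D ∈ H, charSum n D) ^ 4 ≤
      (N + 1) * (n + 1) * (Fintype.card F : ℝ) ^ (4 * N + 3 * n) := by
  set Q := (Fintype.card F : ℝ) with hQ
  have hQ0 : 0 ≤ Q := by positivity
  have hsq : ∑ f ∈ Mn F n, (∑ D ∈ H, (jacobiP D f : ℝ)) ^ 2 =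
      ∑ E ∈ Mn F (2 * N), mulCount H E * charSum n E := by
    calc _ = ∑ p ∈ H ×ˢ H, charSum n (p.1 * p.2) := by
          simp only [charSum]
          rw [Finset.sum_comm]
          refine Finset.sum_congr rfl fun f _ => ?_
          rw [sq, Finset.sum_mul_sum, Finset.sum_product]
          refine Finset.sum_congr rfl fun D _ => Finset.sum_congr rfl fun E _ => ?_
          rw [jacobiP_mul_left]; push_cast; rfl
      _ = _ := by
          rw [← Finset.sum_fiberwise_of_maps_to (s := H ×ˢ H) (t := Mn F (2 * N))
            (g := fun p => p.1 * p.2)]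
          · refine Finset.sum_congr rfl fun E _ => ?_
            rw [mulCount, ← nsmul_eq_mul, ← Finset.sum_const]
            refine Finset.sum_congr rfl fun p hp => ?_
            rw [(Finset.mem_filter.1 hp).2]
          · intro p hp
            rw [Finset.mem_product] at hp
            rw [two_mul]
            exact mul_mem_Mn (hH hp.1) (hH hp.2)
  have h1 : (∑ D ∈ H, charSum n D) ^ 2 ≤
      Q ^ n * ∑ E ∈ Mn F (2 * N), mulCount H E * charSum n E := by
    rw [← hsq]
    simp only [charSum]
    rw [Finset.sum_comm]
    have := sq_sum_le_card_mul_sum_sq (s := Mn F n) (f := fun f => ∑ D ∈ H, (jacobiP D f : ℝ))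
    rwa [card_Mn, Nat.cast_pow] at this
  have h2 := sq_sum_charSum_le h4 (n := n) (M := 2 * N) (by omega) (mulCount H)
  calc (∑ D ∈ H, charSum n D) ^ 4 = ((∑ D ∈ H, charSum n D) ^ 2) ^ 2 := by ring
    _ ≤ (Q ^ n * ∑ E ∈ Mn F (2 * N), mulCount H E * charSum n E) ^ 2 := by gcongr
    _ = (Q ^ n) ^ 2 * (∑ E ∈ Mn F (2 * N), mulCount H E * charSum n E) ^ 2 := by ring
    _ ≤ (Q ^ n) ^ 2 * (((N + 1) * Q ^ (2 * N)) * (Q ^ (2 * N) * ((n + 1) * Q ^ n))) := by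
        gcongr
        exact h2.trans (mul_le_mul_of_nonneg_right (sum_mulCount_sq_le hH) (by positivity))
    _ = _ := by ring

theorem sq_succ_le_two_pow (n : ℕ) : (n + 1) ^ 2 ≤ 8 * 2 ^ n := by
  rcases lt_or_ge n 5 with h | h
  · interval_cases n <;> norm_num
  · induction n, h using Nat.le_induction with
    | base => norm_num
    | succ n hn ih => rw [pow_succ 2 n]; nlinarith

/-- Uniform bound for averages of `L`-polynomial coefficients over a set of polynomials. -/
theorem abs_sum_charSum_le (h4 : Fintype.card F % 4 = 1) {n N : ℕ} (h : n ≤ N)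
    {H : Finset F[X]} (hH : H ⊆ Mn F N) :
    |∑ D ∈ H, charSum n D| ≤ 2 * (4 / 5) ^ n * (Fintype.card F : ℝ) ^ (N + n) := by
  set Q := (Fintype.card F : ℝ) with hQ
  have hQ5 : 5 ≤ Q := by
    have : 1 < Fintype.card F := Fintype.one_lt_card
    have : 5 ≤ Fintype.card F := by omega
    rw [hQ]; exact_mod_cast this
  have hn2 : ((n : ℝ) + 1) ^ 2 ≤ 8 * 2 ^ n := by exact_mod_cast sq_succ_le_two_pow n
  have hfour : (∑ D ∈ H, charSum n D) ^ 4 ≤ 2 * (n + 1) ^ 2 * Q ^ (4 * N + 3 * n) := by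
    rcases le_or_gt (2 * n) N with h2 | h2
    · have h3 := sq_sum_subset_charSum_le h4 h2 hH
      calc (∑ D ∈ H, charSum n D) ^ 4 = ((∑ D ∈ H, charSum n D) ^ 2) ^ 2 := by ring
        _ ≤ ((n + 1) * Q ^ (2 * N + n)) ^ 2 := by gcongr
        _ = (n + 1) ^ 2 * Q ^ (4 * N + 2 * n) := by ring
        _ ≤ (n + 1) ^ 2 * Q ^ (4 * N + 3 * n) := by gcongr; linarith; omega
        _ ≤ _ := by
          have : 0 ≤ ((n : ℝ) + 1) ^ 2 * Q ^ (4 * N + 3 * n) := by positivity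
          linarith
    · refine (pow_four_sum_subset_charSum_le h4 h hH).trans ?_
      have : (N : ℝ) + 1 ≤ 2 * (n + 1) := by
        have : N + 1 ≤ 2 * (n + 1) := by omega
        exact_mod_cast this
      rw [sq, ← mul_assoc]
      gcongr
  have hpow : (2 : ℝ) ^ n * Q ^ (4 * N + 3 * n) ≤ ((4 / 5) ^ n * Q ^ (N + n)) ^ 4 := by
    have : ((4 / 5) ^ n * Q ^ (N + n)) ^ 4 = ((4 / 5) ^ 4 * Q) ^ n * Q ^ (4 * N + 3 * n) := by
      rw [mul_pow, mul_pow _ Q, ← pow_mul, ← pow_mul, ← pow_mul]; ring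
    rw [this]
    gcongr
    norm_num; linarith
  have : |∑ D ∈ H, charSum n D| ^ 4 ≤ (2 * (4 / 5) ^ n * Q ^ (N + n)) ^ 4 := by
    rw [Even.pow_abs (by decide)]
    refine hfour.trans ?_
    calc 2 * ((n : ℝ) + 1) ^ 2 * Q ^ (4 * N + 3 * n)
        ≤ 2 * (8 * 2 ^ n) * Q ^ (4 * N + 3 * n) := by gcongr
      _ = 16 * (2 ^ n * Q ^ (4 * N + 3 * n)) := by ring
      _ ≤ 16 * ((4 / 5) ^ n * Q ^ (N + n)) ^ 4 := by gcongr
      _ = _ := by ring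
  exact le_of_pow_le_pow_left₀ (by norm_num) (by positivity) this

theorem five_le_card (h4 : Fintype.card F % 4 = 1) : (5 : ℝ) ≤ Fintype.card F := by
  have : 1 < Fintype.card F := Fintype.one_lt_card
  have : 5 ≤ Fintype.card F := by omega
  exact_mod_cast this

variable (F) in
/-- Monic square-free polynomials of degree `n`. -/
noncomputable def sqfreeMonic (n : ℕ) : Finset F[X] := (Mn F n).filter fun D => Squarefree D

theorem mem_sqfreeMonic {n : ℕ} {f : F[X]} :
    f ∈ sqfreeMonic F n ↔ (f.Monic ∧ f.natDegree = n) ∧ Squarefree f := by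
  simp [sqfreeMonic, mem_Mn]

theorem sum_Mn_eq_sum_sqfreeMonic (N : ℕ) (φ : F[X] → ℝ) :
    ∑ D ∈ Mn F N, φ D = ∑ k ∈ Finset.range (N / 2 + 1), ∑ l ∈ Mn F k,
      ∑ E ∈ sqfreeMonic F (N - 2 * k), φ (l ^ 2 * E) := by
  simp only [← Finset.sum_product']
  rw [Finset.sum_sigma']
  symm
  refine Finset.sum_bij (fun x _ => x.2.1 ^ 2 * x.2.2) ?_ ?_ ?_ fun _ _ => rfl
  · rintro ⟨k, l, E⟩ h
    simp only [Finset.mem_sigma, Finset.mem_range, Finset.mem_product, mem_Mn,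
      mem_sqfreeMonic] at h ⊢
    obtain ⟨hk, ⟨hl, rfl⟩, ⟨hE, hEd⟩, -⟩ := h
    refine ⟨(hl.pow 2).mul hE, ?_⟩
    rw [(hl.pow 2).natDegree_mul hE, hl.natDegree_pow]
    omega
  · rintro ⟨k, l, E⟩ h ⟨k', l', E'⟩ h' heq
    simp only [Finset.mem_sigma, Finset.mem_range, Finset.mem_product, mem_Mn,
      mem_sqfreeMonic] at h h' heq
    obtain ⟨-, ⟨hl, rfl⟩, -, hE⟩ := h
    obtain ⟨-, ⟨hl', rfl⟩, -, hE'⟩ := h'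
    obtain ⟨rfl, rfl⟩ := sq_mul_squarefree_unique hl hl' hE hE' heq
    rfl
  · intro D hD
    obtain ⟨hDm, hDd⟩ := mem_Mn.1 hD
    obtain ⟨l, E, hl, hE, hEs, rfl⟩ := exists_sq_mul_squarefree hDm
    rw [(hl.pow 2).natDegree_mul hE, hl.natDegree_pow] at hDd
    refine ⟨⟨l.natDegree, l, E⟩, ?_, rfl⟩
    simp only [Finset.mem_sigma, Finset.mem_range, Finset.mem_product, mem_Mn,
      mem_sqfreeMonic]
    exact ⟨by omega, ⟨hl, trivial⟩, ⟨hE, by omega⟩, hEs⟩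

theorem card_sqfreeMonic_add_two (N : ℕ) :
    ((sqfreeMonic F (N + 2)).card : ℝ) =
      (Fintype.card F : ℝ) ^ (N + 2) - (Fintype.card F : ℝ) ^ (N + 1) := by
  have key : ∀ N, (Fintype.card F : ℝ) ^ N = ∑ k ∈ Finset.range (N / 2 + 1),
      (Fintype.card F : ℝ) ^ k * (sqfreeMonic F (N - 2 * k)).card := by
    intro N
    have := sum_Mn_eq_sum_sqfreeMonic (F := F) N fun _ => 1
    simpa [card_Mn] using this
  have h1 := key (N + 2)
  rw [show (N + 2) / 2 + 1 = (N / 2 + 1) + 1 by omega, Finset.sum_range_succ'] at h1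
  have h2 : ∑ k ∈ Finset.range (N / 2 + 1), (Fintype.card F : ℝ) ^ (k + 1) *
      ((sqfreeMonic F (N + 2 - 2 * (k + 1))).card : ℝ) = Fintype.card F * (Fintype.card F : ℝ) ^ N := by
    rw [key N, Finset.mul_sum]
    refine Finset.sum_congr rfl fun k _ => ?_
    rw [show N + 2 - 2 * (k + 1) = N - 2 * k by omega]; ring
  rw [h2] at h1
  simp only [pow_zero, one_mul, mul_zero, Nat.sub_zero] at h1
  rw [pow_succ' _ N]; linarith

theorem card_sqfreeMonic_le (N : ℕ) :
    ((sqfreeMonic F N).card : ℝ) ≤ (Fintype.card F : ℝ) ^ N := by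
  have := Finset.card_filter_le (Mn F N) (fun D => Squarefree D)
  rw [card_Mn] at this
  exact_mod_cast this

/-- The number of monic square-free polynomials of degree `N` prime to every element of `s`. -/
noncomputable def coprimeCount (s : Finset (MonicPrime F)) (N : ℕ) : ℝ :=
  ((sqfreeMonic F N).filter fun D => ∀ P ∈ s, ¬ P.1 ∣ D).card

theorem coprimeCount_add (s : Finset (MonicPrime F)) {P : MonicPrime F} (hP : P ∉ s) (N : ℕ) :
    coprimeCount s (N + P.1.natDegree) =
      coprimeCount (insert P s) (N + P.1.natDegree) + coprimeCount (insert P s) N := by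
  have hprime := P.2.2.prime
  have h := Finset.card_filter_add_card_filter_not
    (s := (sqfreeMonic F (N + P.1.natDegree)).filter fun D => ∀ Q ∈ s, ¬ Q.1 ∣ D)
    (fun D => ¬ P.1 ∣ D)
  rw [Finset.filter_filter, Finset.filter_filter] at h
  have h1 : ((sqfreeMonic F (N + P.1.natDegree)).filter
      fun D => (∀ Q ∈ s, ¬ Q.1 ∣ D) ∧ ¬ P.1 ∣ D) =
      ((sqfreeMonic F (N + P.1.natDegree)).filter fun D => ∀ Q ∈ insert P s, ¬ Q.1 ∣ D) := by
    refine Finset.filter_congr fun D _ => ?_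
    simp only [Finset.mem_insert, forall_eq_or_imp]
    tauto
  have h2 : ((sqfreeMonic F N).filter fun D => ∀ Q ∈ insert P s, ¬ Q.1 ∣ D).card =
      ((sqfreeMonic F (N + P.1.natDegree)).filter
      fun D => (∀ Q ∈ s, ¬ Q.1 ∣ D) ∧ ¬ ¬ P.1 ∣ D).card := by
    refine Finset.card_bij (fun D _ => P.1 * D) ?_ ?_ ?_
    · intro D hD
      simp only [Finset.mem_filter, mem_sqfreeMonic, Finset.mem_insert, forall_eq_or_imp] at hD ⊢
      obtain ⟨⟨⟨hDm, rfl⟩, hDs⟩, hPD, hQ⟩ := hD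
      refine ⟨⟨⟨P.2.1.mul hDm, by rw [P.2.1.natDegree_mul hDm, add_comm]⟩, ?_⟩, ?_, ?_⟩
      · rw [squarefree_mul_iff]
        exact ⟨(hprime.irreducible.coprime_iff_not_dvd.2 hPD).isRelPrime,
          hprime.irreducible.squarefree, hDs⟩
      · intro Q hQs hQd
        rcases Q.2.2.prime.dvd_or_dvd hQd with h' | h'
        · have : Q = P := Subtype.ext (eq_of_monic_of_associated Q.2.1 P.2.1
            (Q.2.2.associated_of_dvd P.2.2 h'))
          exact hP (this ▸ hQs)
        · exact hQ Q hQs h'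
      · simp
    · intro D _ E _ hDE
      exact mul_left_cancel₀ P.2.1.ne_zero hDE
    · intro D hD
      simp only [Finset.mem_filter, mem_sqfreeMonic, not_not] at hD
      obtain ⟨⟨⟨hDm, hDd⟩, hDs⟩, hQ, ⟨E, rfl⟩⟩ := hD
      have hE := P.2.1.of_mul_monic_left hDm
      rw [P.2.1.natDegree_mul hE] at hDd
      refine ⟨E, ?_, rfl⟩
      simp only [Finset.mem_filter, mem_sqfreeMonic, Finset.mem_insert, forall_eq_or_imp]
      refine ⟨⟨⟨hE, by omega⟩, hDs.squarefree_of_dvd (Dvd.intro_left _ rfl)⟩, ?_,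
        fun Q hQs hQE => hQ Q hQs (hQE.mul_left _)⟩
      intro hPE
      exact P.2.2.not_isUnit (hDs P.1 (mul_dvd_mul_left _ hPE))
  rw [h1, ← h2] at h
  unfold coprimeCount
  exact_mod_cast h.symm

theorem exists_geometric_bound {x : ℕ → ℝ} {d : ℕ} {r C θ : ℝ} (hd : 0 < d) (hθ : 0 < θ)
    (hr : r ≤ θ ^ d / 2)
    (h : ∀ N, |x (N + d)| ≤ r * |x N| + C * θ ^ (N + d)) :
    ∃ C', ∀ N, |x N| ≤ C' * θ ^ N := by
  set B := ∑ M ∈ Finset.range d, |x M| / θ ^ M with hB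
  refine ⟨max (2 * C) B, fun N => ?_⟩
  induction N using Nat.strong_induction_on with
  | _ N ih =>
    rcases lt_or_ge N d with hN | hN
    · have h1 : |x N| / θ ^ N ≤ B :=
        Finset.single_le_sum (f := fun M => |x M| / θ ^ M) (fun _ _ => by positivity)
          (Finset.mem_range.2 hN)
      rw [div_le_iff₀ (by positivity)] at h1
      exact h1.trans (by gcongr; exact le_max_right _ _)
    · obtain ⟨M, rfl⟩ := Nat.exists_eq_add_of_le' hN
      have h1 := ih M (by omega)
      have h0 : 0 ≤ max (2 * C) B * θ ^ M := (abs_nonneg _).trans h1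
      calc |x (M + d)| ≤ r * |x M| + C * θ ^ (M + d) := h M
        _ ≤ θ ^ d / 2 * (max (2 * C) B * θ ^ M) + (max (2 * C) B / 2) * θ ^ (M + d) := by
            gcongr
            have := le_max_left (2 * C) B
            linarith
        _ = _ := by rw [pow_add]; ring

/-- The factor `|P| / (|P| + 1)`, the density of square-free polynomials prime to `P`. -/
noncomputable def primeDensity (P : MonicPrime F) : ℝ :=
  (Fintype.card F : ℝ) ^ P.1.natDegree / ((Fintype.card F : ℝ) ^ P.1.natDegree + 1)

theorem exists_coprimeCount_bound (h4 : Fintype.card F % 4 = 1) (s : Finset (MonicPrime F)) :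
    ∃ C, ∀ N, |coprimeCount s N / (Fintype.card F : ℝ) ^ N -
      (1 - 1 / (Fintype.card F : ℝ)) * ∏ P ∈ s, primeDensity P| ≤ C * (3 / 4) ^ N := by
  set Q := (Fintype.card F : ℝ) with hQ
  have hQ5 : 5 ≤ Q := five_le_card h4
  have hQ0 : 0 < Q := by linarith
  induction s using Finset.induction_on with
  | empty =>
    refine ⟨2, fun N => ?_⟩
    have h0 : coprimeCount (∅ : Finset (MonicPrime F)) N = (sqfreeMonic F N).card := by
      simp [coprimeCount]
    have hnn : (0 : ℝ) ≤ (sqfreeMonic F N).card / Q ^ N := by positivity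
    have hle1 : ((sqfreeMonic F N).card : ℝ) / Q ^ N ≤ 1 := by
      rw [div_le_one (by positivity)]; exact card_sqfreeMonic_le N
    have hQinv : 0 ≤ 1 / Q := by positivity
    have hQinv' : 1 / Q ≤ 1 / 5 := one_div_le_one_div_of_le (by norm_num) hQ5
    rw [h0, Finset.prod_empty, mul_one]
    have habs : |((sqfreeMonic F N).card : ℝ) / Q ^ N - (1 - 1 / Q)| ≤ 1 :=
      abs_le.2 ⟨by linarith, by linarith⟩
    match N, habs with
    | 0, h | 1, h => exact h.trans (by norm_num)
    | N + 2, _ =>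
      rw [card_sqfreeMonic_add_two, ← hQ]
      have : (Q ^ (N + 2) - Q ^ (N + 1)) / Q ^ (N + 2) - (1 - 1 / Q) = 0 := by
        field_simp; ring
      rw [this, abs_zero]; positivity
  | insert P s hP ih =>
    obtain ⟨C, hC⟩ := ih
    have hd : 0 < P.1.natDegree := P.2.2.natDegree_pos
    set d := P.1.natDegree with hdd
    set L := (1 - 1 / Q) * ∏ P ∈ s, primeDensity P with hL
    have hL' : (1 - 1 / Q) * ∏ R ∈ insert P s, primeDensity R = L / (1 + 1 / Q ^ d) := by
      rw [Finset.prod_insert hP, hL, primeDensity, ← hQ, ← hdd]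
      have : 0 < Q ^ d := by positivity
      field_simp
    rw [hL']
    set L' := L / (1 + 1 / Q ^ d) with hL'd
    have hLL : L = L' + 1 / Q ^ d * L' := by
      have : 0 < Q ^ d := by positivity
      rw [hL'd]; field_simp
    refine exists_geometric_bound (r := 1 / Q ^ d) (C := C) hd (by norm_num) ?_ ?_
    · have h1 : (1 / Q ^ d) ≤ (1 / 5) ^ d := by
        rw [div_pow, one_pow]; gcongr
      have h2 : ((1 : ℝ) / 5) ^ d = (3 / 4) ^ d * (4 / 15) ^ d := by rw [← mul_pow]; norm_num
      have h3 : ((4 : ℝ) / 15) ^ d ≤ 1 / 2 :=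
        (pow_le_of_le_one (by norm_num) (by norm_num) hd.ne').trans (by norm_num)
      have h5 : (0 : ℝ) ≤ (3 / 4) ^ d := by positivity
      nlinarith
    · intro N
      have h1 := hC (N + d)
      rw [coprimeCount_add s hP N] at h1
      have h2 : coprimeCount (insert P s) (N + d) / Q ^ (N + d) - L' =
          ((coprimeCount (insert P s) (N + d) + coprimeCount (insert P s) N) / Q ^ (N + d) - L) -
          1 / Q ^ d * (coprimeCount (insert P s) N / Q ^ N - L') := by
        rw [hLL, pow_add]
        have : 0 < Q ^ d := by positivity
        field_simp
        ring
      rw [h2]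
      refine (abs_sub _ _).trans ?_
      rw [abs_mul, abs_of_nonneg (a := 1 / Q ^ d) (by positivity), add_comm]
      gcongr

theorem abs_sum_sqfreeMonic_jacobiP_le (N : ℕ) (f : F[X]) :
    |∑ D ∈ sqfreeMonic F N, (jacobiP D f : ℝ)| ≤ (Fintype.card F : ℝ) ^ N := by
  refine (Finset.abs_sum_le_sum_abs _ _).trans
    ((Finset.sum_le_card_nsmul _ _ 1 fun D _ => abs_jacobiP_le_one D f).trans ?_)
  simpa using card_sqfreeMonic_le N

theorem abs_sum_sqfreeMonic_jacobiP_le_of_not_isSquare (h4 : Fintype.card F % 4 = 1)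
    {f : F[X]} (hf : f.Monic) (hsq : ¬ IsSquare f) (N : ℕ) :
    |∑ D ∈ sqfreeMonic F N, (jacobiP D f : ℝ)| ≤
      (4 / 3) ^ f.natDegree * ((3 / 4) * (Fintype.card F : ℝ)) ^ N := by
  set Q := (Fintype.card F : ℝ) with hQ
  have hQ5 : 5 ≤ Q := five_le_card h4
  set S : ℕ → ℝ := fun N => ∑ D ∈ sqfreeMonic F N, (jacobiP D f : ℝ) with hS
  set K : ℝ := (4 / 3) ^ f.natDegree with hK
  have hK0 : 0 < K := by positivity
  change |S N| ≤ _
  induction N using Nat.strong_induction_on with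
  | _ N ih =>
    rcases lt_or_ge N f.natDegree with hN | hN
    · refine (abs_sum_sqfreeMonic_jacobiP_le N f).trans ?_
      rw [mul_pow, ← mul_assoc]
      have : (1 : ℝ) ≤ K * (3 / 4) ^ N := by
        calc (1 : ℝ) = (4 / 3) ^ N * (3 / 4) ^ N := by rw [← mul_pow]; norm_num
          _ ≤ _ := by rw [hK]; gcongr; norm_num
      exact le_mul_of_one_le_left (by positivity) this
    · have h0 := sum_jacobiP_eq_zero h4 hf hsq hN
      rw [sum_Mn_eq_sum_sqfreeMonic, Finset.sum_range_succ'] at h0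
      have hMn0 : Mn F 0 = {1} := by
        ext g
        simp only [mem_Mn, Finset.mem_singleton]
        exact ⟨fun h => h.1.natDegree_eq_zero.1 h.2, by rintro rfl; simp⟩
      have hterm : ∀ k, |∑ l ∈ Mn F k, ∑ E ∈ sqfreeMonic F (N - 2 * k),
          (jacobiP (l ^ 2 * E) f : ℝ)| ≤ Q ^ k * |S (N - 2 * k)| := by
        intro k
        have hl : ∀ l, ∑ E ∈ sqfreeMonic F (N - 2 * k), (jacobiP (l ^ 2 * E) f : ℝ) =
            (jacobiP l f : ℝ) ^ 2 * S (N - 2 * k) := by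
          intro l
          rw [hS, Finset.mul_sum]
          refine Finset.sum_congr rfl fun E _ => ?_
          rw [jacobiP_mul_left, sq, jacobiP_mul_left]; push_cast; ring
        simp only [hl]
        refine (Finset.abs_sum_le_sum_abs _ _).trans
          ((Finset.sum_le_card_nsmul _ _ |S (N - 2 * k)| fun l _ => ?_).trans ?_)
        · rw [abs_mul, abs_pow]
          exact mul_le_of_le_one_left (abs_nonneg _)
            (pow_le_one₀ (abs_nonneg _) (abs_jacobiP_le_one l f))
        · rw [card_Mn, nsmul_eq_mul]; push_cast; rfl
      have hS0 : S N = -∑ k ∈ Finset.range (N / 2), ∑ l ∈ Mn F (k + 1),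
          ∑ E ∈ sqfreeMonic F (N - 2 * (k + 1)), (jacobiP (l ^ 2 * E) f : ℝ) := by
        simp only [hMn0, Finset.sum_singleton, one_pow, one_mul, mul_zero, Nat.sub_zero] at h0
        simp only [hS]
        linarith
      rw [hS0, abs_neg]
      have hhalf : ∀ m, ∑ k ∈ Finset.range m, ((1 : ℝ) / 2) ^ (k + 1) ≤ 1 := by
        intro m
        have : ∑ k ∈ Finset.range m, ((1 : ℝ) / 2) ^ (k + 1) = 1 - (1 / 2) ^ m := by
          induction m with
          | zero => simp
          | succ m ihm => rw [Finset.sum_range_succ, ihm]; ring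
        rw [this]
        have : (0 : ℝ) ≤ (1 / 2) ^ m := by positivity
        linarith
      calc _ ≤ ∑ k ∈ Finset.range (N / 2), Q ^ (k + 1) * |S (N - 2 * (k + 1))| :=
            (Finset.abs_sum_le_sum_abs _ _).trans (Finset.sum_le_sum fun k _ => hterm (k + 1))
        _ ≤ ∑ k ∈ Finset.range (N / 2), K * (3 / 4 * Q) ^ N * (1 / 2) ^ (k + 1) := by
            refine Finset.sum_le_sum fun k hk => ?_
            have hk := Finset.mem_range.1 hk
            have h1 := ih (N - 2 * (k + 1)) (by omega)
            have h2 : (3 / 4 * Q) ^ N =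
                (3 / 4 * Q) ^ (N - 2 * (k + 1)) * ((3 / 4 * Q) ^ 2) ^ (k + 1) := by
              rw [← pow_mul, ← pow_add]; congr 1; omega
            have h3 : Q ^ (k + 1) ≤ ((3 / 4 * Q) ^ 2) ^ (k + 1) * (1 / 2) ^ (k + 1) := by
              rw [← mul_pow]
              gcongr
              nlinarith
            calc Q ^ (k + 1) * |S (N - 2 * (k + 1))|
                ≤ (((3 / 4 * Q) ^ 2) ^ (k + 1) * (1 / 2) ^ (k + 1)) *
                  (K * (3 / 4 * Q) ^ (N - 2 * (k + 1))) := by gcongr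
              _ = _ := by rw [h2]; ring
        _ = K * (3 / 4 * Q) ^ N * ∑ k ∈ Finset.range (N / 2), (1 / 2) ^ (k + 1) := by
            rw [Finset.mul_sum]
        _ ≤ K * (3 / 4 * Q) ^ N * 1 := by gcongr; exact hhalf _
        _ = _ := mul_one _

theorem card_sqfreeMonic {N : ℕ} (hN : 2 ≤ N) :
    ((sqfreeMonic F N).card : ℝ) =
      (Fintype.card F : ℝ) ^ N * (1 - 1 / (Fintype.card F : ℝ)) := by
  obtain ⟨M, rfl⟩ := Nat.exists_eq_add_of_le' hN
  rw [card_sqfreeMonic_add_two]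
  have : (Fintype.card F : ℝ) ≠ 0 := by exact_mod_cast Fintype.card_ne_zero
  field_simp
  ring

theorem sum_jacobiP_sq (N : ℕ) {l : F[X]} (hl : l ≠ 0) :
    ∑ D ∈ sqfreeMonic F N, (jacobiP D (l ^ 2) : ℝ) = coprimeCount (primesOf l) N := by
  rw [coprimeCount, Finset.card_filter]
  push_cast
  refine Finset.sum_congr rfl fun D _ => ?_
  rw [sq, jacobiP_mul_self D hl]
  have := exists_mem_normalizedFactors_iff (f := l) (fun P => P ∣ D)
  by_cases h : ∃ P ∈ primesOf l, P.1 ∣ D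
  · rw [if_pos (this.2 h), if_neg (by push Not; exact h)]; simp
  · rw [if_neg (this.not.2 h), if_pos (by push Not at h; exact h)]; simp

/-- The mean value of `χ_D(f)` over square-free `D`. -/
noncomputable def meanChar (f : F[X]) : ℝ :=
  if IsSquare f then ∏ P ∈ primesOf f, primeDensity P else 0

theorem tendsto_three_quarters_pow (C : ℝ) :
    Tendsto (fun N : ℕ => C * (3 / 4 : ℝ) ^ N) atTop (𝓝 0) := by
  simpa using (tendsto_pow_atTop_nhds_zero_of_lt_one (r := (3 / 4 : ℝ)) (by norm_num)
    (by norm_num)).const_mul C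

theorem tendsto_mean_jacobiP (h4 : Fintype.card F % 4 = 1) {f : F[X]} (hf : f.Monic) :
    Tendsto (fun N => (∑ D ∈ sqfreeMonic F N, (jacobiP D f : ℝ)) / (sqfreeMonic F N).card)
      atTop (𝓝 (meanChar f)) := by
  set Q := (Fintype.card F : ℝ) with hQ
  have hQ5 : 5 ≤ Q := five_le_card h4
  have hQ1 : 0 < 1 - 1 / Q := by
    have : 1 / Q ≤ 1 / 5 := one_div_le_one_div_of_le (by norm_num) hQ5
    linarith
  have key : Tendsto (fun N => (∑ D ∈ sqfreeMonic F N, (jacobiP D f : ℝ)) / Q ^ N)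
      atTop (𝓝 ((1 - 1 / Q) * meanChar f)) := by
    rw [tendsto_iff_norm_sub_tendsto_zero]
    by_cases hsq : IsSquare f
    · obtain ⟨l, hl, rfl⟩ := exists_monic_of_isSquare hf hsq
      obtain ⟨C, hC⟩ := exists_coprimeCount_bound h4 (primesOf l)
      refine squeeze_zero (fun _ => norm_nonneg _) (fun N => ?_) (tendsto_three_quarters_pow C)
      rw [sum_jacobiP_sq N hl.ne_zero, meanChar, if_pos hsq, primesOf_sq hl.ne_zero]
      exact hC N
    · refine squeeze_zero (fun _ => norm_nonneg _) (fun N => ?_)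
        (tendsto_three_quarters_pow ((4 / 3) ^ f.natDegree))
      have := abs_sum_sqfreeMonic_jacobiP_le_of_not_isSquare h4 hf hsq N
      rw [meanChar, if_neg hsq, mul_zero, sub_zero, Real.norm_eq_abs, abs_div,
        abs_of_pos (by positivity : 0 < Q ^ N), div_le_iff₀ (by positivity)]
      rwa [mul_pow, ← mul_assoc] at this
  have := key.div_const (1 - 1 / Q)
  rw [mul_div_cancel_left₀ _ hQ1.ne'] at this
  refine this.congr' ?_
  filter_upwards [eventually_ge_atTop 2] with N hN
  rw [card_sqfreeMonic hN, div_div]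

theorem tendsto_mean_L (h4 : Fintype.card F % 4 = 1) :
    Tendsto (fun g : ℕ => (∑ D ∈ sqfreeMonic F (2 * g + 1), ∑ n ∈ Finset.range (2 * g + 1),
        charSum n D * (Fintype.card F : ℝ) ^ (-(n : ℤ))) / (sqfreeMonic F (2 * g + 1)).card)
      atTop (𝓝 (∑' n, (∑ f ∈ Mn F n, meanChar f) * (Fintype.card F : ℝ) ^ (-(n : ℤ)))) := by
  set Q := (Fintype.card F : ℝ) with hQ
  have hQ5 : 5 ≤ Q := five_le_card h4
  have hQ1 : 1 / Q ≤ 1 / 5 := one_div_le_one_div_of_le (by norm_num) hQ5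
  set H : ℕ → Finset F[X] := fun g => sqfreeMonic F (2 * g + 1) with hH
  set T : ℕ → ℕ → ℝ := fun g n => if n < 2 * g + 1 then
    (∑ f ∈ Mn F n, (∑ D ∈ H g, (jacobiP D f : ℝ)) / (H g).card) * Q ^ (-(n : ℤ)) else 0 with hT
  have hTsum : ∀ g, (∑ D ∈ H g, ∑ n ∈ Finset.range (2 * g + 1),
      charSum n D * Q ^ (-(n : ℤ))) / (H g).card = ∑' n, T g n := by
    intro g
    rw [tsum_eq_sum (s := Finset.range (2 * g + 1))
      fun n hn => if_neg (by simpa using hn), Finset.sum_comm, Finset.sum_div]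
    refine Finset.sum_congr rfl fun n hn => ?_
    rw [if_pos (Finset.mem_range.1 hn), ← Finset.sum_div, Finset.sum_comm, ← Finset.sum_mul]
    simp only [charSum]
    ring
  refine Tendsto.congr (fun g => (hTsum g).symm) ?_
  refine tendsto_tsum_of_dominated_convergence (bound := fun n => 5 / 2 * (4 / 5 : ℝ) ^ n)
    ((summable_geometric_of_lt_one (by norm_num) (by norm_num)).mul_left _) ?_ ?_
  · intro n
    have h2 : Tendsto (fun g : ℕ => 2 * g + 1) atTop atTop :=
      tendsto_atTop_mono (fun g => (by omega : g ≤ 2 * g + 1)) tendsto_id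
    have h1 : Tendsto (fun g => (∑ f ∈ Mn F n, (∑ D ∈ H g, (jacobiP D f : ℝ)) / (H g).card) *
        Q ^ (-(n : ℤ))) atTop (𝓝 ((∑ f ∈ Mn F n, meanChar f) * Q ^ (-(n : ℤ)))) :=
      (tendsto_finsetSum _ fun f hf =>
        (tendsto_mean_jacobiP h4 (mem_Mn.1 hf).1).comp h2).mul_const _
    refine h1.congr' ?_
    filter_upwards [eventually_ge_atTop n] with g hg
    rw [hT]
    dsimp only
    rw [if_pos (by omega)]
  · filter_upwards [eventually_ge_atTop 1] with g hg n
    rw [hT]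
    dsimp only
    split_ifs with hn
    · have hcard : ((H g).card : ℝ) = Q ^ (2 * g + 1) * (1 - 1 / Q) := card_sqfreeMonic (by omega)
      have hcard' : 4 / 5 * Q ^ (2 * g + 1) ≤ ((H g).card : ℝ) := by
        rw [hcard, mul_comm]
        gcongr
        linarith
      have hpos : (0 : ℝ) < (H g).card := lt_of_lt_of_le (by positivity) hcard'
      have hb := abs_sum_charSum_le h4 hn.le (H := H g) (Finset.filter_subset _ _)
      have heq : (∑ f ∈ Mn F n, (∑ D ∈ H g, (jacobiP D f : ℝ)) / (H g).card) * Q ^ (-(n : ℤ)) =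
          (∑ D ∈ H g, charSum n D) / ((H g).card * Q ^ n) := by
        rw [← Finset.sum_div, Finset.sum_comm, zpow_neg, zpow_natCast, ← div_eq_mul_inv, div_div]
        rfl
      rw [heq, Real.norm_eq_abs, abs_div, abs_of_pos (by positivity : 0 < (H g).card * Q ^ n),
        div_le_iff₀ (by positivity)]
      calc _ ≤ 2 * (4 / 5) ^ n * Q ^ (2 * g + 1 + n) := hb
        _ = 5 / 2 * (4 / 5) ^ n * ((4 / 5 * Q ^ (2 * g + 1)) * Q ^ n) := by rw [pow_add]; ring
        _ ≤ _ := by gcongr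
    · simp only [norm_zero]; positivity

theorem sum_meanChar_of_odd {n : ℕ} (hn : Odd n) : ∑ f ∈ Mn F n, meanChar f = 0 := by
  refine Finset.sum_eq_zero fun f h => ?_
  obtain ⟨hf, rfl⟩ := mem_Mn.1 h
  rw [meanChar, if_neg]
  rintro hsq
  obtain ⟨l, hl, rfl⟩ := exists_monic_of_isSquare hf hsq
  rw [hl.natDegree_pow] at hn
  exact Nat.not_odd_iff_even.2 (even_two_mul _) hn

theorem sum_meanChar_two_mul (k : ℕ) : ∑ f ∈ Mn F (2 * k), meanChar f =
    ∑ l ∈ Mn F k, ∏ P ∈ primesOf l, primeDensity P := by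
  symm
  refine Finset.sum_of_injOn (· ^ 2) ?_ ?_ ?_ ?_
  · intro l hl m hm h
    exact (sq_mul_squarefree_unique (mem_Mn.1 hl).1 (mem_Mn.1 hm).1 squarefree_one squarefree_one
      (by simpa using h)).1
  · intro l h
    obtain ⟨hl, rfl⟩ := mem_Mn.1 h
    exact mem_Mn.2 ⟨hl.pow 2, hl.natDegree_pow 2⟩
  · intro f hf hn
    obtain ⟨hf, hd⟩ := mem_Mn.1 hf
    rw [meanChar, if_neg]
    rintro hsq
    obtain ⟨l, hl, rfl⟩ := exists_monic_of_isSquare hf hsq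
    rw [hl.natDegree_pow] at hd
    exact hn ⟨l, mem_Mn.2 ⟨hl, by omega⟩, rfl⟩
  · intro l h
    obtain ⟨hl, rfl⟩ := mem_Mn.1 h
    rw [meanChar, if_pos (IsSquare.sq l), primesOf_sq hl.ne_zero]

theorem tsum_meanChar : ∑' n, (∑ f ∈ Mn F n, meanChar f) * (Fintype.card F : ℝ) ^ (-(n : ℤ)) =
    ∑' k : ℕ, (∑ l ∈ Mn F k, ∏ P ∈ primesOf l, primeDensity P) /
      ((Fintype.card F : ℝ) ^ 2) ^ k := by
  have hinj : Function.Injective fun k : ℕ => 2 * k := fun a b h => by simpa using h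
  rw [← hinj.tsum_eq]
  · refine tsum_congr fun k => ?_
    rw [sum_meanChar_two_mul, zpow_neg, zpow_natCast, pow_mul, div_eq_mul_inv]
  · intro n hn
    by_contra h
    have hodd : Odd n := by
      rw [← Nat.not_even_iff_odd]
      rintro ⟨k, rfl⟩
      exact h ⟨k, by simp [two_mul]⟩
    exact hn (by simp [sum_meanChar_of_odd hodd])

theorem card_filter_dvd {m : F[X]} (hm : m.Monic) (k : ℕ) :
    ((Mn F (k + m.natDegree)).filter fun l => m ∣ l).card = Fintype.card F ^ k := by
  rw [← card_Mn, eq_comm]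
  refine Finset.card_bij (fun l _ => m * l) ?_ ?_ ?_
  · intro l h
    obtain ⟨hl, rfl⟩ := mem_Mn.1 h
    rw [Finset.mem_filter, mem_Mn]
    exact ⟨⟨hm.mul hl, by rw [hm.natDegree_mul hl, add_comm]⟩, dvd_mul_right _ _⟩
  · intro l _ l' _ h
    exact mul_left_cancel₀ hm.ne_zero h
  · intro l h
    rw [Finset.mem_filter, mem_Mn] at h
    obtain ⟨⟨hl, hd⟩, l', rfl⟩ := h
    have hl' := hm.of_mul_monic_left hl
    rw [hm.natDegree_mul hl'] at hd
    exact ⟨l', mem_Mn.2 ⟨hl', by omega⟩, rfl⟩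

theorem card_filter_dvd_of_lt {m : F[X]} {k : ℕ} (hk : k < m.natDegree) :
    ((Mn F k).filter fun l => m ∣ l).card = 0 := by
  rw [Finset.card_eq_zero, Finset.filter_eq_empty_iff]
  intro l h hd
  obtain ⟨hl, rfl⟩ := mem_Mn.1 h
  exact absurd (natDegree_le_of_dvd hd hl.ne_zero) (by omega)

theorem hasSum_card_filter_dvd {m : F[X]} (hm : m.Monic) :
    HasSum (fun k : ℕ => (((Mn F k).filter fun l => m ∣ l).card : ℝ) /
      ((Fintype.card F : ℝ) ^ 2) ^ k)
      ((1 - 1 / (Fintype.card F : ℝ))⁻¹ / ((Fintype.card F : ℝ) ^ m.natDegree) ^ 2) := by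
  set Q := (Fintype.card F : ℝ) with hQ
  have hQ1 : 1 < Q := by rw [hQ]; exact_mod_cast Fintype.one_lt_card
  have hinj : Function.Injective fun k : ℕ => k + m.natDegree := add_left_injective _
  rw [← hinj.hasSum_iff]
  · have h := (hasSum_geometric_of_lt_one (r := 1 / Q) (by positivity)
      (by rw [div_lt_one (by positivity)]; exact hQ1)).div_const ((Q ^ m.natDegree) ^ 2)
    refine h.congr_fun ?_
    intro k
    simp only [Function.comp_apply]
    rw [card_filter_dvd hm, pow_add, one_div_pow]
    push_cast
    rw [← hQ]
    field_simp
    ring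
  · intro k hk
    rw [card_filter_dvd_of_lt]
    · simp
    · by_contra h
      exact hk ⟨k - m.natDegree, by simp only; omega⟩

theorem primeDensity_eq (P : MonicPrime F) :
    primeDensity P = 1 + -1 / ((Fintype.card F : ℝ) ^ P.1.natDegree + 1) := by
  have : (0 : ℝ) < (Fintype.card F : ℝ) ^ P.1.natDegree + 1 := by positivity
  rw [primeDensity]
  field_simp
  ring

/-- The local factors of the Euler product, minus one. -/
noncomputable def eulerTerm (P : MonicPrime F) : ℝ :=
  -1 / (((Fintype.card F : ℝ) ^ P.1.natDegree + 1) * ((Fintype.card F : ℝ) ^ P.1.natDegree) ^ 2)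

theorem summable_norm_eulerTerm : Summable fun P : MonicPrime F => ‖eulerTerm P‖ := by
  set Q := (Fintype.card F : ℝ) with hQ
  have hQ1 : 1 < Q := by rw [hQ]; exact_mod_cast Fintype.one_lt_card
  have hgeo : Summable fun n : ℕ => (1 / Q ^ 2) ^ n :=
    summable_geometric_of_lt_one (by positivity)
      (by rw [div_lt_one (by positivity)]; exact one_lt_pow₀ hQ1 two_ne_zero)
  refine summable_of_sum_le (c := ∑' n : ℕ, (1 / Q ^ 2) ^ n) (fun _ => norm_nonneg _) fun u => ?_
  set N := u.sup fun P => P.1.natDegree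
  have hle : ∀ P : MonicPrime F, ‖eulerTerm P‖ ≤ 1 / (Q ^ 3) ^ P.1.natDegree := by
    intro P
    have hp : 0 < Q ^ P.1.natDegree := by positivity
    rw [eulerTerm, ← hQ, Real.norm_eq_abs, abs_div, abs_neg, abs_one, abs_of_pos (by positivity),
      pow_right_comm Q 3]
    gcongr
    nlinarith [sq_nonneg (Q ^ P.1.natDegree)]
  calc ∑ P ∈ u, ‖eulerTerm P‖ ≤ ∑ P ∈ u, 1 / (Q ^ 3) ^ P.1.natDegree :=
        Finset.sum_le_sum fun P _ => hle P
    _ = ∑ f ∈ u.map (Function.Embedding.subtype _), 1 / (Q ^ 3) ^ f.natDegree := by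
        rw [Finset.sum_map]; rfl
    _ ≤ ∑ f ∈ (Finset.range (N + 1)).biUnion (Mn F), 1 / (Q ^ 3) ^ f.natDegree := by
        refine Finset.sum_le_sum_of_subset_of_nonneg ?_ fun _ _ _ => by positivity
        intro f hf
        obtain ⟨P, hP, rfl⟩ := Finset.mem_map.1 hf
        refine Finset.mem_biUnion.2 ⟨P.1.natDegree, ?_, mem_Mn.2 ⟨P.2.1, rfl⟩⟩
        rw [Finset.mem_range, Nat.lt_succ_iff]
        exact Finset.le_sup (f := fun P : MonicPrime F => P.1.natDegree) hP
    _ ≤ ∑ n ∈ Finset.range (N + 1), ∑ f ∈ Mn F n, 1 / (Q ^ 3) ^ f.natDegree := by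
        refine (Finset.sum_biUnion ?_).le
        intro a _ b _ hab
        refine Finset.disjoint_left.2 fun f ha hb => hab ?_
        exact (mem_Mn.1 ha).2.symm.trans (mem_Mn.1 hb).2
    _ = ∑ n ∈ Finset.range (N + 1), (1 / Q ^ 2) ^ n := by
        refine Finset.sum_congr rfl fun n _ => ?_
        rw [Finset.sum_congr rfl fun f hf => by rw [(mem_Mn.1 hf).2], Finset.sum_const, card_Mn,
          nsmul_eq_mul]
        push_cast
        rw [← hQ, ← mul_div_assoc, mul_one, one_div_pow, ← pow_mul, ← pow_mul,
          div_eq_div_iff (by positivity) (by positivity), ← pow_add, one_mul]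
        ring_nf
    _ ≤ _ := hgeo.sum_le_tsum _ fun _ _ => by positivity

theorem tsum_prod_primeDensity :
    ∑' k : ℕ, (∑ l ∈ Mn F k, ∏ P ∈ primesOf l, primeDensity P) / ((Fintype.card F : ℝ) ^ 2) ^ k =
      (1 - 1 / (Fintype.card F : ℝ))⁻¹ * ∏' P : MonicPrime F, (1 + eulerTerm P) := by
  set Q := (Fintype.card F : ℝ) with hQ
  have hQ1 : 1 < Q := by rw [hQ]; exact_mod_cast Fintype.one_lt_card
  have hQinv : 0 < (1 - 1 / Q)⁻¹ := by
    rw [inv_pos, sub_pos, div_lt_one (by positivity)]; exact hQ1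
  set y : MonicPrime F → ℝ := fun P => -1 / (Q ^ P.1.natDegree + 1) with hy
  set A : Finset (MonicPrime F) → ℕ → ℝ := fun s k =>
    (((Mn F k).filter fun l => ∏ P ∈ s, P.1 ∣ l).card : ℝ) / (Q ^ 2) ^ k with hA
  have hA0 : ∀ s k, 0 ≤ A s k := fun s k => by positivity
  have hAsum : ∀ s, HasSum (A s) ((1 - 1 / Q)⁻¹ / (∏ P ∈ s, (Q ^ P.1.natDegree) ^ 2)) := by
    intro s
    have h := hasSum_card_filter_dvd (monic_prod_monicPrime s)
    rwa [natDegree_prod_of_monic _ _ fun P _ => P.2.1, ← hQ, ← Finset.prod_pow_eq_pow_sum,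
      ← Finset.prod_pow] at h
  have heuler : ∀ s : Finset (MonicPrime F), (∏ P ∈ s, y P) *
      ((1 - 1 / Q)⁻¹ / (∏ P ∈ s, (Q ^ P.1.natDegree) ^ 2)) =
      (1 - 1 / Q)⁻¹ * ∏ P ∈ s, eulerTerm P := by
    intro s
    have : ∏ P ∈ s, eulerTerm P = (∏ P ∈ s, y P) / ∏ P ∈ s, (Q ^ P.1.natDegree) ^ 2 := by
      rw [← Finset.prod_div_distrib]
      refine Finset.prod_congr rfl fun P _ => ?_
      rw [eulerTerm, hy, div_div]
    rw [this]; ring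
  have hsummable : Summable (Function.uncurry fun s k => (∏ P ∈ s, y P) * A s k) := by
    rw [← summable_norm_iff, summable_prod_of_nonneg fun _ => norm_nonneg _]
    have hn : ∀ s, HasSum (fun k => ‖(∏ P ∈ s, y P) * A s k‖)
        ((1 - 1 / Q)⁻¹ * ‖∏ P ∈ s, eulerTerm P‖) := by
      intro s
      have h := (hAsum s).mul_left ‖∏ P ∈ s, y P‖
      have hc : ‖∏ P ∈ s, y P‖ * ((1 - 1 / Q)⁻¹ / (∏ P ∈ s, (Q ^ P.1.natDegree) ^ 2)) =
          (1 - 1 / Q)⁻¹ * ‖∏ P ∈ s, eulerTerm P‖ := by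
        have := congrArg norm (heuler s)
        rwa [norm_mul, norm_mul, Real.norm_of_nonneg hQinv.le,
          Real.norm_of_nonneg (div_nonneg hQinv.le (Finset.prod_nonneg fun _ _ => by positivity))]
          at this
      rw [hc] at h
      refine h.congr_fun fun k => ?_
      rw [norm_mul, Real.norm_of_nonneg (hA0 s k)]
    refine ⟨fun s => (hn s).summable, ?_⟩
    simp only [Function.uncurry_apply_pair, (hn _).tsum_eq]
    exact ((summable_finsetProd_of_summable_norm summable_norm_eulerTerm).norm).mul_left _
  have hk : ∀ k, (∑ l ∈ Mn F k, ∏ P ∈ primesOf l, primeDensity P) / (Q ^ 2) ^ k =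
      ∑' s, (∏ P ∈ s, y P) * A s k := by
    intro k
    have h1 : HasSum (fun s => ∑ l ∈ Mn F k, if s ⊆ primesOf l then ∏ P ∈ s, y P else 0)
        (∑ l ∈ Mn F k, ∏ P ∈ primesOf l, primeDensity P) := by
      refine hasSum_sum fun l _ => ?_
      have : ∏ P ∈ primesOf l, primeDensity P = ∑ s ∈ (primesOf l).powerset,
          if s ⊆ primesOf l then ∏ P ∈ s, y P else 0 := by
        simp only [primeDensity_eq, Finset.prod_one_add]
        exact Finset.sum_congr rfl fun s hs => (if_pos (Finset.mem_powerset.1 hs)).symm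
      rw [this]
      exact hasSum_sum_of_ne_finset_zero fun s hs => if_neg (by simpa using hs)
    rw [← (h1.div_const _).tsum_eq]
    refine tsum_congr fun s => ?_
    rw [hA, ← mul_div_assoc, ← Finset.sum_filter, Finset.sum_const, nsmul_eq_mul, mul_comm]
    congr 4
    exact Finset.filter_congr fun l hl => subset_primesOf_iff (mem_Mn.1 hl).1.ne_zero
  simp only [hk]
  rw [hsummable.tsum_comm, tprod_one_add (summable_finsetProd_of_summable_norm
    summable_norm_eulerTerm), ← tsum_mul_left]
  refine tsum_congr fun s => ?_
  rw [tsum_mul_left, (hAsum s).tsum_eq, heuler]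

end QuadraticMean

/-- For fixed `𝔽_q` with `q ≡ 1 (mod 4)`, as `g → ∞` the average of
`L(1,χ_D)` over monic square-free `D` of degree `2g+1` tends to `ζ_A(2) P(2)`, where
`ζ_A(2) = 1/(1-q⁻¹)` and `P(2) = ∏_{P monic irreducible} (1 - 1/((|P|+1)|P|²))`.
Here `L(1,χ_D) = ∑_{n=0}^{2g} (∑_{f monic, deg f = n} χ_D(f)) q^{-n}`. -/
theorem mean_value_L_at_one (F : Type) [Field F] [Fintype F]
    (h4 : Fintype.card F % 4 = 1) :
    Filter.Tendsto
      (fun g : ℕ =>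
        (∑ D ∈ (Mn F (2 * g + 1)).filter (fun D => Squarefree D),
            ∑ n ∈ Finset.range (2 * g + 1),
              (∑ f ∈ Mn F n, (jacobiP D f : ℝ)) * (Fintype.card F : ℝ) ^ (-(n : ℤ)))
          / (((Mn F (2 * g + 1)).filter (fun D => Squarefree D)).card : ℝ))
      Filter.atTop
      (nhds ((1 - 1 / (Fintype.card F : ℝ))⁻¹ *
        ∏' P : {P : Polynomial F // P.Monic ∧ Irreducible P},
          (1 - 1 / (((Fintype.card F : ℝ) ^ P.1.natDegree + 1) *
            ((Fintype.card F : ℝ) ^ P.1.natDegree) ^ 2)))) := by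
  have h := QuadraticMean.tendsto_mean_L h4
  rw [QuadraticMean.tsum_meanChar, QuadraticMean.tsum_prod_primeDensity] at h
  simp only [QuadraticMean.eulerTerm, neg_div, ← sub_eq_add_neg] at h
  exact h
end
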